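/- arXiv:2312.13021 — 12 statements merged into one kernel-verified Lean document; each statement's English description precedes it below -/
import Mathlib

section
/- Let n ≥ 1 and let p, q, ε ∈ ℝⁿ satisfy ε_i ≥ 0, p_i > −ε_i and q_i > −ε_i for all i, and Σ_{i=1}^n p_i = Σ_{i=1}^n q_i. Then the shifted Kullback-Leibler divergence satisfies D_sKL^ε(p‖q) ≥ 0. -/
open Finset

/-- The shifted Kullback-Leibler (sKL) divergence of `p` from `q` with
shift-parameter vector `ε`:
`D_sKL^ε(p‖q) = Σ_i (p_i + ε_i) log((p_i + ε_i)/(q_i + ε_i))`.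
(The convention `0 · log(0/x) = 0` is automatic in Lean.) -/
noncomputable def sKL {n : ℕ} (ε p q : Fin n → ℝ) : ℝ :=
  ∑ i, (p i + ε i) * Real.log ((p i + ε i) / (q i + ε i))

/-- Nonnegativity of the sKL divergence. -/
theorem sKL_nonneg {n : ℕ} (hn : 1 ≤ n) (p q ε : Fin n → ℝ)
    (hε : ∀ i, 0 ≤ ε i) (hp : ∀ i, -ε i < p i) (hq : ∀ i, -ε i < q i)
    (hsum : ∑ i, p i = ∑ i, q i) :
    0 ≤ sKL ε p q := by
  have key : ∀ i, p i - q i ≤ (p i + ε i) * Real.log ((p i + ε i) / (q i + ε i)) := by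
    intro i
    have ha : 0 < p i + ε i := by linarith [hp i]
    have hb : 0 < q i + ε i := by linarith [hq i]
    have h := Real.one_sub_inv_le_log_of_pos (div_pos ha hb)
    have h2 := mul_le_mul_of_nonneg_left h ha.le
    have h3 : (p i + ε i) * (1 - ((p i + ε i) / (q i + ε i))⁻¹) = p i - q i := by
      rw [inv_div, mul_sub, mul_div_cancel₀ _ ha.ne']
      ring
    linarith
  have h := Finset.sum_le_sum (fun i (_ : i ∈ Finset.univ) => key i)
  rw [Finset.sum_sub_distrib, hsum, sub_self] at h
  exact h
end

section
/- Let n ≥ 1 and let p, q, ε ∈ ℝⁿ satisfy ε_i ≥ 0, p_i > −ε_i and q_i > −ε_i for all i, and Σ_{i=1}^n p_i = Σ_{i=1}^n q_i. Then D_sKL^ε(p‖q) = 0 if and only if p = q. -/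
open Finset

/-- The sKL divergence vanishes if and only if `p = q`. -/
theorem sKL_eq_zero_iff {n : ℕ} (hn : 1 ≤ n) (p q ε : Fin n → ℝ)
    (hε : ∀ i, 0 ≤ ε i) (hp : ∀ i, -ε i < p i) (hq : ∀ i, -ε i < q i)
    (hsum : ∑ i, p i = ∑ i, q i) :
    sKL ε p q = 0 ↔ p = q := by
  constructor
  · intro h
    have key : ∀ i, p i - q i ≤ (p i + ε i) * Real.log ((p i + ε i) / (q i + ε i)) ∧
        (p i ≠ q i →
          p i - q i < (p i + ε i) * Real.log ((p i + ε i) / (q i + ε i))) := by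
      intro i
      have ha : 0 < p i + ε i := by linarith [hp i]
      have hb : 0 < q i + ε i := by linarith [hq i]
      have hx : 0 < (q i + ε i) / (p i + ε i) := div_pos hb ha
      have hlog : Real.log ((p i + ε i) / (q i + ε i))
          = -Real.log ((q i + ε i) / (p i + ε i)) := by
        rw [← Real.log_inv, inv_div]
      have hmul : (p i + ε i) * ((q i + ε i) / (p i + ε i)) = q i + ε i :=
        by field_simp
      rw [hlog]
      constructor
      · have h1 := mul_le_mul_of_nonneg_left (Real.log_le_sub_one_of_pos hx) ha.le
        rw [mul_sub, hmul] at h1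
        linarith
      · intro hne
        have hne1 : (q i + ε i) / (p i + ε i) ≠ 1 := by
          intro h1
          rw [div_eq_one_iff_eq ha.ne'] at h1
          exact hne (by linarith)
        have h1 := mul_lt_mul_of_pos_left (Real.log_lt_sub_one_of_pos hx hne1) ha
        rw [mul_sub, hmul] at h1
        linarith
    by_contra hpq
    obtain ⟨j, hj⟩ := Function.ne_iff.mp hpq
    have hlt : ∑ i, (p i - q i) < sKL ε p q :=
      Finset.sum_lt_sum (fun i _ => (key i).1) ⟨j, Finset.mem_univ j, (key j).2 hj⟩
    rw [Finset.sum_sub_distrib, hsum, h, sub_self] at hlt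
    exact lt_irrefl _ hlt
  · rintro rfl
    unfold sKL
    apply Finset.sum_eq_zero
    intro i _
    have ha : p i + ε i ≠ 0 := ne_of_gt (by linarith [hp i])
    rw [div_self ha, Real.log_one, mul_zero]
end

section
/- Let n ≥ 1 and let p, ε ∈ ℝⁿ satisfy ε_i ≥ 0 and p_i > −ε_i for all i. Consider the map q ↦ D_sKL^ε(p‖q) on the open set {q ∈ ℝⁿ : q_i > −ε_i for all i}. Its second partial derivatives at q = p are ∂²D_sKL^ε(p‖q)/∂q_i∂q_j |_{q=p} = δ_ij/(p_i + ε_i), and the n×n matrix with these entries (the diagonal matrix with positive diagonal entries 1/(p_i + ε_i)) is positive definite. -/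
open Finset

theorem sKL_hasFDerivAt {n : ℕ} (p ε q : Fin n → ℝ)
    (hp : ∀ i, -ε i < p i) (hq : ∀ i, -ε i < q i) :
    HasFDerivAt (fun q' : Fin n → ℝ => sKL ε p q')
      (∑ i, (-((p i + ε i) / (q i + ε i))) •
        (ContinuousLinearMap.proj i : (Fin n → ℝ) →L[ℝ] ℝ)) q := by
  unfold sKL
  refine HasFDerivAt.fun_sum fun i _ => ?_
  have ha : p i + ε i ≠ 0 := by linarith [hp i]
  have hb : q i + ε i ≠ 0 := by linarith [hq i]
  have h1 : HasDerivAt (fun t : ℝ => (p i + ε i) * Real.log ((p i + ε i) / (t + ε i)))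
      (-((p i + ε i) / (q i + ε i))) (q i) := by
    have h2 := ((((hasDerivAt_id (q i)).add_const (ε i)).fun_inv hb).const_mul (p i + ε i)).log
      (mul_ne_zero ha (inv_ne_zero hb))
    have h3 := h2.const_mul (p i + ε i)
    simp only [id, ← div_eq_mul_inv] at h3
    refine h3.congr_deriv ?_
    field_simp
  exact HasDerivAt.comp_hasFDerivAt (f := fun r : Fin n → ℝ => r i) q h1
    (ContinuousLinearMap.proj (R := ℝ) (φ := fun _ : Fin n => ℝ) i).hasFDerivAt

/-- The second partial derivatives of `q ↦ D_sKL^ε(p‖q)` at `q = p` are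
`δ_ij / (p_i + ε_i)`, and the resulting Hessian matrix is positive definite. -/
theorem sKL_hessian {n : ℕ} (hn : 1 ≤ n) (p ε : Fin n → ℝ)
    (hε : ∀ i, 0 ≤ ε i) (hp : ∀ i, -ε i < p i) :
    (∀ i j : Fin n,
      fderiv ℝ (fun q : Fin n → ℝ =>
          fderiv ℝ (fun q' : Fin n → ℝ => sKL ε p q') q (Pi.single j 1))
        p (Pi.single i 1)
        = if i = j then 1 / (p i + ε i) else 0) ∧
    Matrix.PosDef (Matrix.of fun i j : Fin n =>
      if i = j then 1 / (p i + ε i) else 0) := by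
  constructor
  · intro i j
    have hev : (fun q : Fin n → ℝ =>
        fderiv ℝ (fun q' : Fin n → ℝ => sKL ε p q') q (Pi.single j 1))
        =ᶠ[nhds p] fun q => -((p j + ε j) / (q j + ε j)) := by
      have hU : ∀ᶠ q : Fin n → ℝ in nhds p, ∀ i, -ε i < q i := by
        rw [Filter.eventually_all]
        intro i
        exact (continuous_apply i).continuousAt.eventually (lt_mem_nhds (hp i))
      filter_upwards [hU] with q hq
      rw [(sKL_hasFDerivAt p ε q hp hq).fderiv]
      simp [Pi.single_apply]
    rw [hev.fderiv_eq]
    have hb : p j + ε j ≠ 0 := by linarith [hp j]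
    have h1 : HasDerivAt (fun t : ℝ => -((p j + ε j) / (t + ε j)))
        (1 / (p j + ε j)) (p j) := by
      have h2 := ((((hasDerivAt_id (p j)).add_const (ε j)).fun_inv hb).const_mul
        (p j + ε j)).fun_neg
      simp only [id, ← div_eq_mul_inv] at h2
      refine h2.congr_deriv ?_
      field_simp
    have h3 : HasFDerivAt (fun q : Fin n → ℝ => -((p j + ε j) / (q j + ε j)))
        ((1 / (p j + ε j)) • (ContinuousLinearMap.proj j : (Fin n → ℝ) →L[ℝ] ℝ)) p :=
      HasDerivAt.comp_hasFDerivAt (f := fun r : Fin n → ℝ => r j) p h1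
        (ContinuousLinearMap.proj (R := ℝ) (φ := fun _ : Fin n => ℝ) j).hasFDerivAt
    rw [h3.fderiv]
    by_cases hij : i = j
    · subst hij
      simp
    · simp [Pi.single_apply, hij, Ne.symm hij]
  · have hd : (Matrix.of fun i j : Fin n => if i = j then 1 / (p i + ε i) else 0)
        = Matrix.diagonal fun i => 1 / (p i + ε i) := by
      ext i j
      simp [Matrix.diagonal_apply]
    rw [hd]
    refine Matrix.PosDef.diagonal fun i => ?_
    exact one_div_pos.mpr (by linarith [hp i])
end

section
/- Let n ≥ 1, let ε ∈ ℝⁿ with ε_i ≥ 0, and let (p^{(1)}, q^{(1)}) and (p^{(2)}, q^{(2)}) be two pairs of vectors in ℝⁿ with p^{(k)}_i ≥ −ε_i and q^{(k)}_i > −ε_i for all i and k = 1, 2. Then for every λ ∈ [0, 1], D_sKL^ε(λp^{(1)} + (1−λ)p^{(2)} ‖ λq^{(1)} + (1−λ)q^{(2)}) ≤ λ·D_sKL^ε(p^{(1)}‖q^{(1)}) + (1−λ)·D_sKL^ε(p^{(2)}‖q^{(2)}), i.e. the sKL divergence with fixed parameter vector ε is jointly convex in the pair of its arguments. -/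
open Finset

lemma sKL_pointwise_aux (a b c d l m : ℝ) (ha : 0 ≤ a) (hb : 0 < b) (hc : 0 ≤ c) (hd : 0 < d)
    (hl : 0 ≤ l) (hm : 0 ≤ m) (hlm : l + m = 1) :
    (l * a + m * c) * Real.log ((l * a + m * c) / (l * b + m * d))
      ≤ l * (a * Real.log (a / b)) + m * (c * Real.log (c / d)) := by
  have hQ : 0 < l * b + m * d := by
    rcases hl.eq_or_lt with h | h
    · have : m = 1 := by linarith
      subst this; rw [← h]; linarith
    · have := mul_pos h hb
      have := mul_nonneg hm hd.le
      linarith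
  set Q := l * b + m * d with hQd
  have h1 : a / b ∈ Set.Ici (0 : ℝ) := Set.mem_Ici.2 (by positivity)
  have h2 : c / d ∈ Set.Ici (0 : ℝ) := Set.mem_Ici.2 (by positivity)
  have h3 : 0 ≤ l * b / Q := by positivity
  have h4 : 0 ≤ m * d / Q := by positivity
  have h5 : l * b / Q + m * d / Q = 1 := by rw [← add_div, ← hQd, div_self hQ.ne']
  have key := Real.convexOn_mul_log.2 h1 h2 h3 h4 h5
  simp only [smul_eq_mul] at key
  have e : l * b / Q * (a / b) + m * d / Q * (c / d) = (l * a + m * c) / Q := by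
    field_simp
  rw [e] at key
  have k2 := mul_le_mul_of_nonneg_left key hQ.le
  calc _ = Q * ((l * a + m * c) / Q * Real.log ((l * a + m * c) / Q)) := by
        rw [← mul_assoc, mul_div_cancel₀ _ hQ.ne']
    _ ≤ _ := k2
    _ = _ := by
        generalize Real.log (a / b) = u
        generalize Real.log (c / d) = v
        field_simp

/-- The sKL divergence with fixed parameter vector `ε` is jointly convex in the
pair of its arguments. -/
theorem sKL_convex {n : ℕ} (hn : 1 ≤ n) (ε : Fin n → ℝ) (hε : ∀ i, 0 ≤ ε i)
    (p₁ q₁ p₂ q₂ : Fin n → ℝ)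
    (hp₁ : ∀ i, -ε i ≤ p₁ i) (hq₁ : ∀ i, -ε i < q₁ i)
    (hp₂ : ∀ i, -ε i ≤ p₂ i) (hq₂ : ∀ i, -ε i < q₂ i)
    (lam : ℝ) (hl0 : 0 ≤ lam) (hl1 : lam ≤ 1) :
    sKL ε (lam • p₁ + (1 - lam) • p₂) (lam • q₁ + (1 - lam) • q₂)
      ≤ lam * sKL ε p₁ q₁ + (1 - lam) * sKL ε p₂ q₂ := by
  unfold sKL
  rw [Finset.mul_sum, Finset.mul_sum, ← Finset.sum_add_distrib]
  refine Finset.sum_le_sum fun i _ => ?_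
  have h := sKL_pointwise_aux (p₁ i + ε i) (q₁ i + ε i) (p₂ i + ε i) (q₂ i + ε i) lam (1 - lam)
    (by linarith [hp₁ i]) (by linarith [hq₁ i]) (by linarith [hp₂ i]) (by linarith [hq₂ i])
    hl0 (by linarith) (by ring)
  simp only [Pi.add_apply, Pi.smul_apply, smul_eq_mul]
  have e1 : lam * p₁ i + (1 - lam) * p₂ i + ε i
      = lam * (p₁ i + ε i) + (1 - lam) * (p₂ i + ε i) := by ring
  have e2 : lam * q₁ i + (1 - lam) * q₂ i + ε i
      = lam * (q₁ i + ε i) + (1 - lam) * (q₂ i + ε i) := by ring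
  rw [e1, e2]
  exact h
end

section
/- Let p, q ∈ ℝⁿ be probability vectors (nonnegative entries summing to 1) with q_i > 0 whenever p_i > 0. Let f(z) = Σ_{k=1}^m a_k z^{b_k} with real coefficients a_k, exponents b_k ≥ 0, at least one a_k ≠ 0, and f(z) ≥ 0 for all z ≥ 0. Then there exist constants C > 0 and σ₀ > 0 such that for all 0 < σ < σ₀ the expectation E_x[D_sKL^{ε(x)}(p‖q+x)] over a vector x of i.i.d. centered Gaussian random variables with standard deviation σ exists and satisfies | E_x[D_sKL^{ε(x)}(p‖q+x)] − D_KL(p‖q) − σ²·Σ_{i : p_i>0} p_i/(2 q_i²) | ≤ C σ⁴. -/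
open Finset MeasureTheory

/-- The dynamic shift parameter `ε_i(t)`: zero if the noisy entry `q_i + t` is
positive, and `|q_i + t| + f(|q_i + t|)` otherwise. -/
noncomputable def dynShift (qi : ℝ) (f : ℝ → ℝ) (t : ℝ) : ℝ :=
  if 0 < qi + t then 0 else |qi + t| + f |qi + t|

/-- The integrand (without the Gaussian normalization) appearing in the
Gaussian average of the sKL divergence, for the entry `(p_i, q_i)`. -/
noncomputable def sKLIntegrand (pi qi : ℝ) (f : ℝ → ℝ) (σ t : ℝ) : ℝ :=
  Real.exp (-t ^ 2 / (2 * σ ^ 2)) *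
    ((pi + dynShift qi f t) *
      Real.log ((pi + dynShift qi f t) / (qi + t + dynShift qi f t)))

/-- The expectation `E_x[D_sKL^{ε(x)}(p‖q+x)]` over i.i.d. centered Gaussian
noise with standard deviation `σ`, written as a sum over the indices with
`p_i > 0` of one-dimensional Gaussian integrals. -/
noncomputable def expectedSKL {n : ℕ} (p q : Fin n → ℝ) (f : ℝ → ℝ) (σ : ℝ) : ℝ :=
  ∑ i ∈ Finset.univ.filter (fun i => 0 < p i),
    (1 / Real.sqrt (2 * Real.pi * σ ^ 2)) * ∫ t : ℝ, sKLIntegrand (p i) (q i) f σ t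

/-- The Kullback-Leibler divergence `D_KL(p‖q) = Σ_i p_i log(p_i/q_i)` with the
convention `0 · log(0/x) = 0`. -/
noncomputable def klDiv {n : ℕ} (p q : Fin n → ℝ) : ℝ :=
  ∑ i ∈ Finset.univ.filter (fun i => 0 < p i), p i * Real.log (p i / q i)


/-- Leading behaviour at infinity of a finite sum of real powers. -/
lemma powSum_log_atTop {m : ℕ} (a b : Fin m → ℝ) :
    ∃ C : ℝ, 0 ≤ C ∧ ∃ R : ℝ, 1 ≤ R ∧ ∀ z : ℝ, R ≤ z →
      |Real.log (∑ k, a k * z ^ (b k))| ≤ C * (1 + |Real.log z|) := by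
  classical
  set A : ℝ → ℝ := fun β => ∑ k ∈ Finset.univ.filter (fun k => b k = β), a k with hA
  set B : Finset ℝ := (Finset.univ.image b).filter (fun β => A β ≠ 0) with hB
  have hF : ∀ z : ℝ, ∑ k, a k * z ^ (b k) = ∑ β ∈ B, A β * z ^ β := by
    intro z
    rw [hB, Finset.sum_filter_of_ne, ← Finset.sum_fiberwise_of_maps_to (g := b)
      (t := Finset.univ.image b) (fun k _ => Finset.mem_image_of_mem b (Finset.mem_univ k))]
    · refine Finset.sum_congr rfl fun β _ => ?_
      rw [hA, Finset.sum_mul]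
      refine Finset.sum_congr rfl fun k hk => ?_
      rw [(Finset.mem_filter.1 hk).2]
    · intro β _ h h0
      exact h (by rw [h0, zero_mul])
  simp only [hF]
  rcases B.eq_empty_or_nonempty with h | h
  · exact ⟨0, le_rfl, 1, le_rfl, fun z _ => by simp [h]⟩
  · set β₀ := B.max' h
    have hβ₀ : β₀ ∈ B := B.max'_mem h
    have hA0 : A β₀ ≠ 0 := (Finset.mem_filter.1 hβ₀).2
    have hlim : Filter.Tendsto (fun z : ℝ => ∑ β ∈ B, A β * z ^ (β - β₀)) Filter.atTop
        (nhds (A β₀)) := by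
      have : A β₀ = ∑ β ∈ B, if β = β₀ then A β₀ else 0 := by
        rw [Finset.sum_ite_eq' B β₀]; simp [hβ₀]
      rw [this]
      refine tendsto_finsetSum _ fun β hβ => ?_
      split_ifs with he
      · subst he; simp
      · have hlt : β < β₀ := lt_of_le_of_ne (B.le_max' β hβ) he
        have := (tendsto_rpow_neg_atTop (sub_pos.2 hlt)).const_mul (A β)
        simpa using this
    have hlog := (hlim.log hA0).abs
    have hev := hlog.eventually (gt_mem_nhds (lt_add_one _))
    have hne := hlim.eventually_ne hA0
    obtain ⟨R, hR⟩ := Filter.eventually_atTop.1 (hev.and hne)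
    refine ⟨|Real.log (A β₀)| + 1 + |β₀|, by positivity, max R 1, le_max_right _ _, fun z hz => ?_⟩
    obtain ⟨h1, h2⟩ := hR z ((le_max_left _ _).trans hz)
    have hz0 : 0 < z := lt_of_lt_of_le one_pos ((le_max_right _ _).trans hz)
    have heq : ∑ β ∈ B, A β * z ^ β = (∑ β ∈ B, A β * z ^ (β - β₀)) * z ^ β₀ := by
      rw [Finset.sum_mul]
      refine Finset.sum_congr rfl fun β _ => ?_
      rw [mul_assoc, ← Real.rpow_add hz0]; simp
    rw [heq, Real.log_mul h2 (Real.rpow_pos_of_pos hz0 _).ne', Real.log_rpow hz0]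
    refine (abs_add_le _ _).trans ?_
    rw [abs_mul]
    nlinarith [abs_nonneg (Real.log z), abs_nonneg β₀, abs_nonneg (Real.log (A β₀))]

lemma powSum_log_zero {m : ℕ} (a b : Fin m → ℝ) :
    ∃ C : ℝ, 0 ≤ C ∧ ∃ r : ℝ, 0 < r ∧ r ≤ 1 ∧ ∀ z : ℝ, 0 < z → z ≤ r →
      |Real.log (∑ k, a k * z ^ (b k))| ≤ C * (1 + |Real.log z|) := by
  obtain ⟨C, hC, R, hR, h⟩ := powSum_log_atTop a (fun k => - b k)
  refine ⟨C, hC, R⁻¹, by positivity, inv_le_one_of_one_le₀ hR, fun z hz hzr => ?_⟩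
  have := h z⁻¹ ((le_inv_comm₀ hz (by linarith)).1 hzr)
  rw [Real.log_inv, abs_neg] at this
  convert this using 5 with k
  rw [Real.inv_rpow hz.le, Real.rpow_neg hz.le, inv_inv]

lemma powSum_measurable {m : ℕ} (a b : Fin m → ℝ) :
    Measurable (fun z : ℝ => ∑ k, a k * z ^ (b k)) := by
  fun_prop

lemma powSum_log_integrable {m : ℕ} (a b : Fin m → ℝ) :
    IntegrableOn (fun z : ℝ => Real.exp (-z) * |Real.log (∑ k, a k * z ^ (b k))|)
      (Set.Ioi 0) := by
  obtain ⟨C, hC, R, hR, h⟩ := powSum_log_atTop a b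
  obtain ⟨C', hC', r, hr, hr1, h'⟩ := powSum_log_zero a b
  have hm : Measurable (fun z : ℝ => Real.exp (-z) * |Real.log (∑ k, a k * z ^ (b k))|) := by
    fun_prop
  rw [← Set.Ioc_union_Ioi_eq_Ioi (zero_le_one.trans hR),
    ← Set.Ioc_union_Ioc_eq_Ioc hr.le (hr1.trans hR)]
  refine ((IntegrableOn.union ?_ ?_).union ?_)
  · have hi : IntegrableOn (fun z : ℝ => C' * (1 + |Real.log z|)) (Set.Ioc 0 r) := by
      rw [← intervalIntegrable_iff_integrableOn_Ioc_of_le hr.le]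
      exact ((intervalIntegrable_const).add
        (intervalIntegral.intervalIntegrable_log'.abs)).const_mul C'
    refine Integrable.mono' hi hm.aestronglyMeasurable ?_
    refine (ae_restrict_iff' measurableSet_Ioc).2 (Filter.Eventually.of_forall fun z hz => ?_)
    rw [Real.norm_of_nonneg (by positivity)]
    refine le_trans ?_ (h' z hz.1 hz.2)
    refine mul_le_of_le_one_left (abs_nonneg _) ?_
    rw [Real.exp_le_one_iff]; linarith [hz.1]
  · have hmer : MeromorphicOn (fun z : ℝ => ∑ k, a k * z ^ (b k)) (Set.uIcc r R) := by
      intro z hz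
      rw [Set.uIcc_of_le (hr1.trans hR)] at hz
      have hz0 : z ≠ 0 := by linarith [hz.1]
      apply AnalyticAt.meromorphicAt
      refine Finset.analyticAt_fun_sum _ fun k _ => ?_
      refine analyticAt_const.mul ?_
      exact (Real.contDiffAt_rpow_const_of_ne hz0).analyticAt
    have hi := hmer.intervalIntegrable_log.abs
    rw [intervalIntegrable_iff_integrableOn_Ioc_of_le (hr1.trans hR)] at hi
    refine Integrable.mono' hi hm.aestronglyMeasurable ?_
    refine (ae_restrict_iff' measurableSet_Ioc).2 (Filter.Eventually.of_forall fun z hz => ?_)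
    rw [Real.norm_of_nonneg (by positivity)]
    refine mul_le_of_le_one_left (abs_nonneg _) ?_
    rw [Real.exp_le_one_iff]; linarith [hz.1]
  · have hi : IntegrableOn (fun z : ℝ => 2 * C * Real.exp (-(1/2) * z)) (Set.Ioi R) :=
      (integrableOn_exp_mul_Ioi (by norm_num) R).const_mul _
    refine Integrable.mono' hi hm.aestronglyMeasurable ?_
    refine (ae_restrict_iff' measurableSet_Ioi).2 (Filter.Eventually.of_forall fun z hz => ?_)
    rw [Real.norm_of_nonneg (by positivity)]
    have hz1 : 1 ≤ z := hR.trans (le_of_lt hz)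
    have h1 := h z (le_of_lt hz)
    have h2 : |Real.log z| ≤ z - 1 := by
      rw [abs_of_nonneg (Real.log_nonneg hz1)]
      exact Real.log_le_sub_one_of_pos (by linarith)
    have h3 : z ≤ 2 * Real.exp (1/2 * z) := by
      have := Real.add_one_le_exp (1/2*z); linarith
    have h4 : Real.exp (-z) * Real.exp (1/2*z) = Real.exp (-(1/2) * z) := by
      rw [← Real.exp_add]; congr 1; ring
    calc _ ≤ Real.exp (-z) * (C * (2 * Real.exp (1/2 * z))) := by
          gcongr
          refine h1.trans ?_
          gcongr
          linarith
      _ = _ := by rw [← h4]; ring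

lemma gauss_integrable (k : ℕ) {c : ℝ} (hc : 0 < c) :
    Integrable (fun t : ℝ => t ^ k * Real.exp (-c * t ^ 2)) := by
  have := integrable_rpow_mul_exp_neg_mul_sq hc (s := k) (by
    have : (0:ℝ) ≤ k := Nat.cast_nonneg k
    linarith)
  simpa using this

lemma gauss_rec (k : ℕ) {c : ℝ} (hc : 0 < c) :
    2 * c * ∫ t : ℝ, t ^ (k + 1) * Real.exp (-c * t ^ 2) =
      k * ∫ t : ℝ, t ^ (k - 1) * Real.exp (-c * t ^ 2) := by
  have hd : ∀ t : ℝ, HasDerivAt (fun t : ℝ => t ^ k * Real.exp (-c * t ^ 2))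
      (k * (t ^ (k-1) * Real.exp (-c * t ^ 2)) - 2 * c * (t ^ (k+1) * Real.exp (-c * t ^ 2))) t := by
    intro t
    have h1 := (hasDerivAt_pow 2 t).const_mul (-c)
    have := (hasDerivAt_pow k t).mul h1.exp
    refine this.congr_deriv ?_
    simp; ring
  have h1 := (gauss_integrable (k-1) hc).const_mul (k:ℝ)
  have h2 := (gauss_integrable (k+1) hc).const_mul (2*c)
  have := integral_eq_zero_of_hasDerivAt_of_integrable hd (h1.sub h2) (gauss_integrable k hc)
  rw [integral_sub h1 h2, integral_const_mul, integral_const_mul] at this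
  linarith

lemma integrable_comp_abs_of_Ioi {h : ℝ → ℝ} (hh : IntegrableOn h (Set.Ioi 0)) :
    Integrable (fun x => h |x|) := by
  have hf : IntegrableOn (fun x => h |x|) (Set.Ioi 0) := by
    refine hh.congr_fun (fun x hx => ?_) measurableSet_Ioi
    simp only [abs_of_pos (show (0:ℝ) < x from hx)]
  have int_Iic : IntegrableOn (fun x ↦ h |x|) (Set.Iic 0) := by
    rw [← Measure.map_neg_eq_self (volume : Measure ℝ)]
    let m : MeasurableEmbedding fun x : ℝ => -x := (Homeomorph.neg ℝ).measurableEmbedding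
    rw [m.integrableOn_map_iff]
    simp_rw [Function.comp_def, abs_neg, Set.neg_preimage, Set.neg_Iic, neg_zero]
    exact Iff.mpr integrableOn_Ici_iff_integrableOn_Ioi hf
  rw [← integrableOn_univ, ← Set.Iic_union_Ioi (a := (0:ℝ))]
  exact int_Iic.union hf

/-- The integrand without the Gaussian weight. -/
noncomputable def sKLCore (p q : ℝ) (f : ℝ → ℝ) (t : ℝ) : ℝ :=
  (p + dynShift q f t) * Real.log ((p + dynShift q f t) / (q + t + dynShift q f t))

lemma abs_log_div_le (x y : ℝ) : |Real.log (x / y)| ≤ |Real.log x| + |Real.log y| := by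
  by_cases hx : x = 0
  · simp [hx]
  by_cases hy : y = 0
  · simp [hy]
  rw [Real.log_div hx hy]
  exact abs_sub _ _

lemma powSum_le_exp {m : ℕ} (a b : Fin m → ℝ) (hb : ∀ k, 0 ≤ b k) (z : ℝ) (hz : 0 ≤ z) :
    ∑ k, a k * z ^ (b k) ≤ (∑ k, |a k|) * Real.exp ((∑ k, b k) * z) := by
  rw [Finset.sum_mul]
  refine Finset.sum_le_sum fun k _ => ?_
  refine (mul_le_mul_of_nonneg_right (le_abs_self _) (Real.rpow_nonneg hz _)).trans ?_
  refine mul_le_mul_of_nonneg_left ?_ (abs_nonneg _)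
  calc z ^ b k ≤ (Real.exp z) ^ b k :=
        Real.rpow_le_rpow hz (by linarith [Real.add_one_le_exp z]) (hb k)
    _ = Real.exp (b k * z) := by rw [← Real.exp_mul, mul_comm]
    _ ≤ _ := by
        gcongr
        exact Finset.single_le_sum (fun i _ => hb i) (Finset.mem_univ k)

lemma sKLCore_measurable (p q : ℝ) {m : ℕ} (a b : Fin m → ℝ) (f : ℝ → ℝ)
    (hfdef : ∀ z : ℝ, 0 ≤ z → f z = ∑ k, a k * z ^ (b k)) : Measurable (sKLCore p q f) := by
  have hd : Measurable (dynShift q f) := by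
    unfold dynShift
    refine Measurable.ite (measurableSet_lt measurable_const (by fun_prop)) measurable_const ?_
    have : (fun t => |q + t| + f |q + t|) = fun t => |q + t| + ∑ k, a k * |q + t| ^ (b k) := by
      funext t; rw [hfdef _ (abs_nonneg _)]
    rw [this]
    fun_prop
  unfold sKLCore
  fun_prop

lemma sKLCore_bound (p q : ℝ) (hp : 0 < p) {m : ℕ} (a b : Fin m → ℝ)
    (hb : ∀ k, 0 ≤ b k) (f : ℝ → ℝ)
    (hfdef : ∀ z : ℝ, 0 ≤ z → f z = ∑ k, a k * z ^ (b k))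
    (hfnn : ∀ z : ℝ, 0 ≤ z → 0 ≤ f z) :
    ∃ K N : ℝ, 0 ≤ K ∧ 0 ≤ N ∧ ∀ t, |sKLCore p q f t| ≤ K * Real.exp (N * |q + t|) *
      (1 + |Real.log (|q + t|)| + |Real.log (∑ k, a k * |q + t| ^ (b k))|) := by
  set M := p + 1 + ∑ k, |a k| with hM
  have hM0 : 0 ≤ ∑ k, |a k| := Finset.sum_nonneg fun _ _ => abs_nonneg _
  have hMp : p ≤ M := by linarith
  set N := 1 + ∑ k, b k with hN
  have hN0 : 0 ≤ ∑ k, b k := Finset.sum_nonneg fun k _ => hb k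
  set L := M + |Real.log p| + 1 with hL
  have hl0 := abs_nonneg (Real.log p)
  have hM1 : 0 < M := by linarith
  have hL1 : 1 ≤ L := by linarith
  refine ⟨M * L, 2 * N, by positivity, by positivity, fun t => ?_⟩
  set z := |q + t| with hz
  have hz0 : 0 ≤ z := abs_nonneg _
  set l1 := |Real.log z|
  set l2 := |Real.log (∑ k, a k * z ^ (b k))|
  have hl1 : 0 ≤ l1 := abs_nonneg _
  have hl2 : 0 ≤ l2 := abs_nonneg _
  have hE1 : 1 ≤ Real.exp (N * z) := Real.one_le_exp (by positivity)
  have hE2 : Real.exp (2 * N * z) = Real.exp (N * z) * Real.exp (N * z) := by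
    rw [← Real.exp_add]; congr 1; ring
  have key : ∀ A lA l : ℝ, 0 ≤ A → A ≤ M * Real.exp (N * z) → 
      lA ≤ A + |Real.log p| → l ≤ l1 + l2 → 0 ≤ lA + l → 
      A * (lA + l) ≤ M * L * Real.exp (2 * N * z) * (1 + l1 + l2) := by
    intro A lA l hA0 hA hlA hl h0
    have h1 : lA + l ≤ L * Real.exp (N * z) * (1 + l1 + l2) := by
      have : lA + l ≤ (M + |Real.log p|) * Real.exp (N*z) + Real.exp (N*z) * (l1 + l2) := by
        nlinarith
      have h2 : (M + |Real.log p|) * Real.exp (N*z) + Real.exp (N*z) * (l1 + l2) ≤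
          L * Real.exp (N * z) + L * Real.exp (N*z) * (l1 + l2) := by
        have : Real.exp (N*z) * (l1 + l2) ≤ L * (Real.exp (N*z) * (l1 + l2)) :=
          le_mul_of_one_le_left (by positivity) hL1
        nlinarith
      linarith
    calc A * (lA + l) ≤ (M * Real.exp (N * z)) * (L * Real.exp (N * z) * (1 + l1 + l2)) :=
          mul_le_mul hA h1 h0 (by positivity)
      _ = _ := by rw [hE2]; ring
  unfold sKLCore dynShift
  split_ifs with hpos
  · have hzq : q + t = z := (abs_of_pos hpos).symm
    rw [add_zero, add_zero, abs_mul, abs_of_pos hp, hzq]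
    refine (mul_le_mul_of_nonneg_left (abs_log_div_le p z) hp.le).trans ?_
    refine key p _ _ hp.le ?_ (by linarith) (by linarith) (by positivity)
    nlinarith
  · have hzq : q + t = - z := by rw [hz, abs_of_nonpos (not_lt.1 hpos)]; ring
    have hfz := hfnn z hz0
    have e : q + t + (z + f z) = f z := by rw [hzq]; ring
    have hA0 : 0 < p + (z + f z) := by linarith
    rw [← hz, e, abs_mul, abs_of_pos hA0]
    refine (mul_le_mul_of_nonneg_left (abs_log_div_le _ _) hA0.le).trans ?_
    refine key _ _ _ hA0.le ?_ ?_ ?_ (by positivity)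
    · have h1 := powSum_le_exp a b hb z hz0
      rw [← hfdef z hz0] at h1
      have h2 : Real.exp ((∑ k, b k) * z) ≤ Real.exp (N * z) := by
        gcongr; linarith
      have h3 : z ≤ Real.exp (N * z) := by
        have := Real.add_one_le_exp (N*z)
        nlinarith
      have h4 := mul_le_mul_of_nonneg_left h2 hM0
      nlinarith
    · rw [abs_le]
      constructor
      · have : Real.log p ≤ Real.log (p + (z + f z)) := Real.log_le_log hp (by linarith)
        have := neg_abs_le (Real.log p)
        linarith
      · have := Real.log_le_sub_one_of_pos hA0
        linarith
    · rw [hfdef z hz0]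
      show l2 ≤ l1 + l2
      linarith

lemma sKLCore_integrable (p q : ℝ) (hp : 0 < p) (hq : 0 < q) {m : ℕ} (a b : Fin m → ℝ)
    (hb : ∀ k, 0 ≤ b k) (f : ℝ → ℝ)
    (hfdef : ∀ z : ℝ, 0 ≤ z → f z = ∑ k, a k * z ^ (b k))
    (hfnn : ∀ z : ℝ, 0 ≤ z → 0 ≤ f z) :
    Integrable (fun t : ℝ => Real.exp (-(1/4) * t ^ 2) * sKLCore p q f t) := by
  obtain ⟨K, N, hK, hN, h⟩ := sKLCore_bound p q hp a b hb f hfdef hfnn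
  have i0 : IntegrableOn (fun z : ℝ => Real.exp (-z)) (Set.Ioi 0) :=
    integrableOn_exp_neg_Ioi 0
  have i1 := powSum_log_integrable (m := 1) (fun _ => 1) (fun _ => 1)
  have i2 := powSum_log_integrable a b
  have i3 := integrable_comp_abs_of_Ioi ((i0.add i1).add i2)
  have i4 := (i3.comp_add_left q).const_mul (K * Real.exp ((N+1)^2 + (N+1) * q))
  refine i4.mono' ?_ (Filter.Eventually.of_forall fun t => ?_)
  · have := sKLCore_measurable p q a b f hfdef
    exact Measurable.aestronglyMeasurable (by fun_prop)
  · simp only [Pi.add_apply, Finset.univ_unique, Finset.sum_const, Finset.card_singleton,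
      one_smul, one_mul, Real.rpow_one]
    rw [norm_mul, Real.norm_of_nonneg (Real.exp_pos _).le, Real.norm_eq_abs]
    have hexp : Real.exp (-(1/4) * t ^ 2) * Real.exp (N * |q + t|) ≤
        Real.exp ((N+1)^2 + (N+1) * q) * Real.exp (-|q + t|) := by
      rw [← Real.exp_add, ← Real.exp_add]
      apply Real.exp_le_exp.2
      have h1 : |q + t| ≤ q + |t| := (abs_add_le _ _).trans (by rw [abs_of_pos hq])
      have h2 : (N + 1) * |q + t| ≤ (N + 1) * (q + |t|) := by gcongr
      nlinarith [sq_nonneg (|t| / 2 - (N+1)), sq_abs t]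
    have hnn : 0 ≤ K * (1 + |Real.log (|q + t|)| + |Real.log (∑ k, a k * |q + t| ^ (b k))|) := by
      positivity
    calc _ ≤ Real.exp (-(1/4) * t ^ 2) * (K * Real.exp (N * |q + t|) *
          (1 + |Real.log (|q + t|)| + |Real.log (∑ k, a k * |q + t| ^ (b k))|)) :=
          mul_le_mul_of_nonneg_left (h t) (Real.exp_pos _).le
      _ = (Real.exp (-(1/4) * t ^ 2) * Real.exp (N * |q + t|)) * (K *
          (1 + |Real.log (|q + t|)| + |Real.log (∑ k, a k * |q + t| ^ (b k))|)) := by ring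
      _ ≤ _ := mul_le_mul_of_nonneg_right hexp hnn
      _ = _ := by ring

/-- The third order Taylor polynomial of the integrand. -/
noncomputable def sKLTaylor (p q t : ℝ) : ℝ :=
  p * Real.log (p / q) - p / q * t + p / (2 * q ^ 2) * t ^ 2 - p / (3 * q ^ 3) * t ^ 3

lemma sKLCore_taylor (p q : ℝ) (hp : 0 < p) (hq : 0 < q) (f : ℝ → ℝ) (t : ℝ) (ht : |t| ≤ q / 2) :
    |sKLCore p q f t - sKLTaylor p q t| ≤ 2 * p / q ^ 4 * t ^ 4 := by
  have hpos : 0 < q + t := by linarith [neg_abs_le t]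
  have hx : |-(t / q)| ≤ 1 / 2 := by
    rw [abs_neg, abs_div, abs_of_pos hq, div_le_iff₀ hq]; linarith
  have h := Real.abs_log_sub_add_sum_range_le (x := -(t/q)) (by linarith) 3
  have hlog : Real.log (1 - -(t / q)) = Real.log (q + t) - Real.log q := by
    rw [← Real.log_div hpos.ne' hq.ne']; congr 1; field_simp; ring
  have e : sKLCore p q f t - sKLTaylor p q t =
      -p * ((∑ i ∈ range 3, (-(t/q)) ^ (i + 1) / (i + 1)) + Real.log (1 - -(t / q))) := by
    unfold sKLCore dynShift sKLTaylor
    rw [if_pos hpos, hlog, add_zero, add_zero, Real.log_div hp.ne' hpos.ne',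
      Real.log_div hp.ne' hq.ne']
    simp [Finset.sum_range_succ]
    field_simp
    ring
  rw [e, abs_mul, abs_neg, abs_of_pos hp]
  have h2 : |-(t/q)| ^ (3+1) / (1 - |-(t/q)|) ≤ 2 * (t ^ 4 / q ^ 4) := by
    rw [div_le_iff₀ (by linarith)]
    have : |-(t/q)| ^ (3+1) = t ^ 4 / q ^ 4 := by
      rw [abs_neg, Even.pow_abs (by decide), div_pow]
    rw [this]
    have : 0 ≤ t ^ 4 / q ^ 4 := by positivity
    nlinarith
  calc _ ≤ p * (2 * (t^4/q^4)) := mul_le_mul_of_nonneg_left (h.trans h2) hp.le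
    _ = _ := by ring

lemma exp_far_bound (q σ t : ℝ) (hq : 0 < q) (hσ : 0 < σ) (hσ1 : σ < 1) (ht : q / 2 < |t|) :
    Real.exp (-t ^ 2 / (2 * σ ^ 2)) ≤
      (6 * 16 ^ 3 / q ^ 6 * σ ^ 6) * Real.exp (-(1/4) * t ^ 2) := by
  have ht2 : q ^ 2 / 4 ≤ t ^ 2 := by
    rw [← sq_abs t]; nlinarith
  have h1 : -t ^ 2 / (2 * σ ^ 2) ≤ -(q^2 / (16 * σ^2)) + -(1/4) * t ^ 2 := by
    have hs : σ ^ 2 ≤ 1 := by nlinarith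
    have e : -t ^ 2 / (2 * σ ^ 2) - (-(q^2 / (16 * σ^2)) + -(1/4) * t ^ 2)
      = -((t^2 - q^2/4) / (4 * σ^2) + t^2 * (1 - σ^2) / (4 * σ^2)) := by
      field_simp; ring
    have : 0 ≤ (t^2 - q^2/4) / (4 * σ^2) + t^2 * (1 - σ^2) / (4 * σ^2) := by
      have a1 : 0 ≤ t^2 - q^2/4 := by linarith
      have a2 : 0 ≤ 1 - σ^2 := by linarith
      positivity
    linarith
  have h2 : Real.exp (-(q^2 / (16 * σ^2))) ≤ 6 * 16 ^ 3 / q ^ 6 * σ ^ 6 := by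
    have hx : 0 < q^2 / (16 * σ^2) := by positivity
    have := Real.pow_div_factorial_le_exp _ hx.le 3
    rw [Real.exp_neg]
    refine (inv_anti₀ (by positivity) this).trans (le_of_eq ?_)
    simp [Nat.factorial]
    field_simp
  calc _ ≤ Real.exp (-(q^2 / (16 * σ^2)) + -(1/4) * t ^ 2) := Real.exp_le_exp.2 h1
    _ = _ := Real.exp_add _ _
    _ ≤ _ := mul_le_mul_of_nonneg_right h2 (Real.exp_pos _).le

lemma sKL_single (p q : ℝ) (hp : 0 < p) (hq : 0 < q) {m : ℕ} (a b : Fin m → ℝ)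
    (hb : ∀ k, 0 ≤ b k) (f : ℝ → ℝ)
    (hfdef : ∀ z : ℝ, 0 ≤ z → f z = ∑ k, a k * z ^ (b k))
    (hfnn : ∀ z : ℝ, 0 ≤ z → 0 ≤ f z) :
    ∃ C : ℝ, 0 ≤ C ∧ ∀ σ : ℝ, 0 < σ → σ < 1 →
      Integrable (fun t : ℝ => sKLIntegrand p q f σ t) ∧
      |(1 / Real.sqrt (2 * Real.pi * σ ^ 2)) * (∫ t : ℝ, sKLIntegrand p q f σ t)
        - p * Real.log (p / q) - σ ^ 2 * (p / (2 * q ^ 2))| ≤ C * σ ^ 4 := by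
  have hI := sKLCore_integrable p q hp hq a b hb f hfdef hfnn
  have hmeas := sKLCore_measurable p q a b f hfdef
  have hT : ∀ c : ℝ, 0 < c →
      Integrable (fun t : ℝ => Real.exp (-c * t ^ 2) * sKLTaylor p q t) := by
    intro c hc
    have := ((((gauss_integrable 0 hc).const_mul (p * Real.log (p / q))).sub
      ((gauss_integrable 1 hc).const_mul (p / q))).add
      ((gauss_integrable 2 hc).const_mul (p / (2 * q ^ 2)))).sub
      ((gauss_integrable 3 hc).const_mul (p / (3 * q ^ 3)))
    refine this.congr (Filter.Eventually.of_forall fun t => ?_)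
    simp only [Pi.add_apply, Pi.sub_apply, sKLTaylor]
    ring
  have hTi : ∀ c : ℝ, 0 < c →
      ∫ t : ℝ, Real.exp (-c * t ^ 2) * sKLTaylor p q t =
        (p * Real.log (p / q) + p / (2 * q ^ 2) * (1 / (2 * c))) * Real.sqrt (Real.pi / c) := by
    intro c hc
    have j0 := (gauss_integrable 0 hc).const_mul (p * Real.log (p / q))
    have j1 := (gauss_integrable 1 hc).const_mul (p / q)
    have j2 := (gauss_integrable 2 hc).const_mul (p / (2 * q ^ 2))
    have j3 := (gauss_integrable 3 hc).const_mul (p / (3 * q ^ 3))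
    have j01 : Integrable (fun t : ℝ => p * Real.log (p / q) * (t ^ 0 * Real.exp (-c * t ^ 2))
        - p / q * (t ^ 1 * Real.exp (-c * t ^ 2))) := j0.sub j1
    have j02 : Integrable (fun t : ℝ => p * Real.log (p / q) * (t ^ 0 * Real.exp (-c * t ^ 2))
        - p / q * (t ^ 1 * Real.exp (-c * t ^ 2))
        + p / (2 * q ^ 2) * (t ^ 2 * Real.exp (-c * t ^ 2))) := j01.add j2
    have e : ∫ t : ℝ, Real.exp (-c * t ^ 2) * sKLTaylor p q t =
        p * Real.log (p / q) * (∫ t : ℝ, t ^ 0 * Real.exp (-c * t ^ 2))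
        - p / q * (∫ t : ℝ, t ^ 1 * Real.exp (-c * t ^ 2))
        + p / (2 * q ^ 2) * (∫ t : ℝ, t ^ 2 * Real.exp (-c * t ^ 2))
        - p / (3 * q ^ 3) * (∫ t : ℝ, t ^ 3 * Real.exp (-c * t ^ 2)) := by
      rw [← integral_const_mul, ← integral_const_mul, ← integral_const_mul, ← integral_const_mul,
        ← integral_sub j0 j1, ← integral_add j01 j2,
        ← integral_sub j02 j3]
      refine integral_congr_ae (Filter.Eventually.of_forall fun t => ?_)
      simp only [sKLTaylor]
      ring
    have m0 : ∫ t : ℝ, t ^ 0 * Real.exp (-c * t ^ 2) = Real.sqrt (Real.pi / c) := by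
      simpa using integral_gaussian c
    have m1 := gauss_rec 0 hc
    have m2 := gauss_rec 1 hc
    have m3 := gauss_rec 2 hc
    norm_num only [Nat.cast_zero, Nat.cast_one, zero_mul] at m1 m2 m3
    rw [m0] at m2
    have m1' : ∫ t : ℝ, t ^ 1 * Real.exp (-c * t ^ 2) = 0 := by
      rcases mul_eq_zero.1 m1 with h | h
      · linarith
      · exact h
    rw [m1', mul_zero] at m3
    have m3' : ∫ t : ℝ, t ^ 3 * Real.exp (-c * t ^ 2) = 0 := by
      rcases mul_eq_zero.1 m3 with h | h
      · linarith
      · exact h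
    have m2' : ∫ t : ℝ, t ^ 2 * Real.exp (-c * t ^ 2) = 1 / (2 * c) * Real.sqrt (Real.pi / c) := by
      rw [div_mul_eq_mul_div, eq_div_iff (by positivity)]
      linarith
    rw [e, m0, m1', m2', m3']
    ring
  have hM4 : ∀ c : ℝ, 0 < c → ∫ t : ℝ, t ^ 4 * Real.exp (-c * t ^ 2) =
      3 * (1 / (2 * c)) ^ 2 * Real.sqrt (Real.pi / c) := by
    intro c hc
    have m0 : ∫ t : ℝ, t ^ 0 * Real.exp (-c * t ^ 2) = Real.sqrt (Real.pi / c) := by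
      simpa using integral_gaussian c
    have m2 := gauss_rec 1 hc
    have m4 := gauss_rec 3 hc
    norm_num only [Nat.cast_one] at m2 m4
    rw [m0] at m2
    have m2' : ∫ t : ℝ, t ^ 2 * Real.exp (-c * t ^ 2) = 1 / (2 * c) * Real.sqrt (Real.pi / c) := by
      rw [div_mul_eq_mul_div, eq_div_iff (by positivity)]
      linarith
    rw [m2'] at m4
    generalize (∫ t : ℝ, t ^ 4 * Real.exp (-c * t ^ 2)) = x at m4 ⊢
    generalize Real.sqrt (Real.pi / c) = y at m4 ⊢
    field_simp at m4 ⊢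
    linarith
  have hD := (hI.sub (hT (1/4) (by norm_num))).abs
  set J := ∫ t : ℝ, |Real.exp (-(1/4) * t ^ 2) * sKLCore p q f t
    - Real.exp (-(1/4) * t ^ 2) * sKLTaylor p q t| with hJ
  have hJ0 : 0 ≤ J := integral_nonneg fun _ => abs_nonneg _
  set K := 2 * p / q ^ 4 with hK
  set Q := 6 * 16 ^ 3 / q ^ 6 with hQ
  have hK0 : 0 ≤ K := by positivity
  have hQ0 : 0 ≤ Q := by positivity
  refine ⟨K * 3 + Q * J, by positivity, fun σ hσ hσ1 => ?_⟩
  have hc : 0 < 1 / (2 * σ ^ 2) := by positivity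
  have hrw : ∀ t : ℝ, -t ^ 2 / (2 * σ ^ 2) = -(1 / (2 * σ ^ 2)) * t ^ 2 := fun t => by ring
  have hσ2 : σ ^ 2 ≤ 1 := by nlinarith
  have hint : Integrable (fun t : ℝ => sKLIntegrand p q f σ t) := by
    refine hI.mono ?_ (Filter.Eventually.of_forall fun t => ?_)
    · change AEStronglyMeasurable (fun t => Real.exp (-t ^ 2 / (2 * σ ^ 2)) * sKLCore p q f t) _
      exact Measurable.aestronglyMeasurable (by fun_prop)
    · change ‖Real.exp (-t ^ 2 / (2 * σ ^ 2)) * sKLCore p q f t‖ ≤ _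
      rw [norm_mul, norm_mul, Real.norm_of_nonneg (Real.exp_pos _).le,
        Real.norm_of_nonneg (Real.exp_pos _).le]
      gcongr
      rw [hrw]
      have : 1 / 4 ≤ 1 / (2 * σ ^ 2) := by
        rw [div_le_div_iff₀ (by norm_num) (by positivity)]; linarith
      nlinarith [sq_nonneg t]
  refine ⟨hint, ?_⟩
  have hS : Real.sqrt (Real.pi / (1 / (2 * σ ^ 2))) = Real.sqrt (2 * Real.pi * σ ^ 2) := by
    congr 1; field_simp
  have hcc : 1 / (2 * (1 / (2 * σ ^ 2))) = σ ^ 2 := by field_simp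
  have hTi' := hTi _ hc
  have hM4' := hM4 _ hc
  rw [hS, hcc] at hTi' hM4'
  set S := Real.sqrt (2 * Real.pi * σ ^ 2) with hSdef
  have hSσ : σ ≤ S := by
    rw [hSdef]
    apply Real.le_sqrt_of_sq_le
    nlinarith [Real.pi_gt_three, sq_nonneg σ]
  have hS0 : 0 < S := hσ.trans_le hSσ
  have hTc := hT _ hc
  have hmain : |(∫ t : ℝ, sKLIntegrand p q f σ t) -
      ∫ t : ℝ, Real.exp (-(1 / (2 * σ ^ 2)) * t ^ 2) * sKLTaylor p q t| ≤
      K * (3 * (σ ^ 2) ^ 2 * S) + Q * σ ^ 6 * J := by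
    rw [← integral_sub hint hTc, ← hM4', hJ, ← integral_const_mul, ← integral_const_mul,
      ← Real.norm_eq_abs]
    have i1 := (gauss_integrable 4 hc).const_mul K
    have i2 := hD.const_mul (Q * σ ^ 6)
    simp only [Pi.sub_apply] at i2
    rw [← integral_add i1 i2]
    refine norm_integral_le_of_norm_le (i1.add i2) (Filter.Eventually.of_forall fun t => ?_)
    change ‖Real.exp (-t ^ 2 / (2 * σ ^ 2)) * sKLCore p q f t - _‖ ≤ _
    rw [← hrw, ← mul_sub, norm_mul, Real.norm_of_nonneg (Real.exp_pos _).le, Real.norm_eq_abs]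
    rw [← mul_sub, abs_mul, abs_of_pos (Real.exp_pos (-(1/4) * t ^ 2))]
    rcases le_or_gt |t| (q / 2) with ht | ht
    · have h1 := mul_le_mul_of_nonneg_left (sKLCore_taylor p q hp hq f t ht)
        (Real.exp_pos (-t ^ 2 / (2 * σ ^ 2))).le
      have h2 : 0 ≤ Q * σ ^ 6 * (Real.exp (-(1/4) * t ^ 2) *
        |sKLCore p q f t - sKLTaylor p q t|) := by positivity
      linarith
    · have h1 := mul_le_mul_of_nonneg_right (exp_far_bound q σ t hq hσ hσ1 ht)
        (abs_nonneg (sKLCore p q f t - sKLTaylor p q t))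
      rw [← hQ, mul_assoc (Q * σ ^ 6)] at h1
      have h2 : 0 ≤ K * (t ^ 4 * Real.exp (-t ^ 2 / (2 * σ ^ 2))) := by positivity
      linarith
  rw [hTi'] at hmain
  set I := ∫ t : ℝ, sKLIntegrand p q f σ t
  have e : 1 / S * I - p * Real.log (p / q) - σ ^ 2 * (p / (2 * q ^ 2)) =
      (I - (p * Real.log (p / q) + p / (2 * q ^ 2) * σ ^ 2) * S) / S := by
    field_simp
    ring
  rw [e, abs_div, abs_of_pos hS0, div_le_iff₀ hS0]
  refine hmain.trans ?_
  have h6 : σ ^ 6 ≤ σ ^ 4 * S := by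
    have : σ ^ 2 ≤ S := by nlinarith
    calc σ ^ 6 = σ ^ 4 * σ ^ 2 := by ring
      _ ≤ _ := by gcongr
  have := mul_le_mul_of_nonneg_left h6 (mul_nonneg hQ0 hJ0)
  nlinarith

/-- For probability vectors `p, q` with `q_i > 0` whenever `p_i > 0`, and a
dynamic shift function `f` which is a nonnegative finite sum of power laws
(not identically given by zero coefficients), the Gaussian average of the sKL
divergence exists for small enough `σ` and differs from
`D_KL(p‖q) + σ² Σ_{i : p_i > 0} p_i/(2 q_i²)` by at most `C σ⁴`. -/
theorem expectedSKL_eq_klDiv_add_sq {n : ℕ} (p q : Fin n → ℝ)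
    (hp0 : ∀ i, 0 ≤ p i) (hq0 : ∀ i, 0 ≤ q i)
    (hp1 : ∑ i, p i = 1) (hq1 : ∑ i, q i = 1)
    (hpq : ∀ i, 0 < p i → 0 < q i)
    (m : ℕ) (hm : 1 ≤ m) (a b : Fin m → ℝ) (hb : ∀ k, 0 ≤ b k)
    (ha : ∃ k, a k ≠ 0) (f : ℝ → ℝ)
    (hfdef : ∀ z : ℝ, 0 ≤ z → f z = ∑ k, a k * z ^ (b k))
    (hfnn : ∀ z : ℝ, 0 ≤ z → 0 ≤ f z) :
    ∃ C > 0, ∃ σ₀ > 0, ∀ σ : ℝ, 0 < σ → σ < σ₀ →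
      (∀ i, 0 < p i → Integrable (fun t : ℝ => sKLIntegrand (p i) (q i) f σ t)) ∧
      |expectedSKL p q f σ - klDiv p q
          - σ ^ 2 * ∑ i ∈ Finset.univ.filter (fun i => 0 < p i), p i / (2 * (q i) ^ 2)|
        ≤ C * σ ^ 4 := by
  classical
  have H : ∀ i, ∃ C : ℝ, 0 ≤ C ∧ (0 < p i → ∀ σ : ℝ, 0 < σ → σ < 1 →
      Integrable (fun t : ℝ => sKLIntegrand (p i) (q i) f σ t) ∧
      |(1 / Real.sqrt (2 * Real.pi * σ ^ 2)) * (∫ t : ℝ, sKLIntegrand (p i) (q i) f σ t)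
        - p i * Real.log (p i / q i) - σ ^ 2 * (p i / (2 * (q i) ^ 2))| ≤ C * σ ^ 4) := by
    intro i
    by_cases h : 0 < p i
    · obtain ⟨C, hC, hh⟩ := sKL_single (p i) (q i) h (hpq i h) a b hb f hfdef hfnn
      exact ⟨C, hC, fun _ => hh⟩
    · exact ⟨0, le_rfl, fun h' => absurd h' h⟩
  choose C hC0 hC using H
  have hs : 0 ≤ ∑ i, C i := Finset.sum_nonneg fun i _ => hC0 i
  refine ⟨∑ i, C i + 1, by linarith, 1, one_pos, fun σ hσ hσ1 => ⟨fun i hi => (hC i hi σ hσ hσ1).1, ?_⟩⟩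
  unfold expectedSKL klDiv
  rw [Finset.mul_sum, ← Finset.sum_sub_distrib, ← Finset.sum_sub_distrib]
  refine (Finset.abs_sum_le_sum_abs _ _).trans ?_
  have h4 : 0 ≤ σ ^ 4 := by positivity
  calc _ ≤ ∑ i ∈ Finset.univ.filter (fun i => 0 < p i), C i * σ ^ 4 :=
        Finset.sum_le_sum fun i hi => (hC i (Finset.mem_filter.1 hi).2 σ hσ hσ1).2
    _ ≤ ∑ i, C i * σ ^ 4 := Finset.sum_le_sum_of_subset_of_nonneg (Finset.filter_subset _ _)
        fun i _ _ => mul_nonneg (hC0 i) h4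
    _ = (∑ i, C i) * σ ^ 4 := by rw [Finset.sum_mul]
    _ ≤ _ := by nlinarith
end

section
/- Let p, q ∈ ℝⁿ be probability vectors (nonnegative entries summing to 1) with q_i > 0 whenever p_i > 0, and let f(z) = Σ_{k=1}^m a_k z^{b_k} with real coefficients a_k, exponents b_k ≥ 0, at least one a_k ≠ 0, and f(z) ≥ 0 for all z ≥ 0. Then the expectation E_x[D_sKL^{ε(x)}(p‖q+x)] over a vector x of i.i.d. centered Gaussian random variables with standard deviation σ converges to D_KL(p‖q) as σ → 0⁺. -/
open Finset MeasureTheory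

open Filter Topology Asymptotics in
theorem gp_lead_top (S : Finset ℝ) (A : ℝ → ℝ) (M : ℝ) (hM : M ∈ S) (hle : ∀ s ∈ S, s ≤ M) :
    Tendsto (fun z : ℝ => ∑ s ∈ S, A s * z ^ (s - M)) atTop (𝓝 (A M)) := by
  have h : A M = ∑ s ∈ S, (if s = M then A M else 0) := by
    simp [hM]
  rw [h]
  refine tendsto_finsetSum _ fun s hs => ?_
  by_cases hsM : s = M
  · subst hsM; simp
  · have h1 : 0 < M - s := by
      have := lt_of_le_of_ne (hle s hs) hsM
      linarith
    have h2 := (tendsto_rpow_neg_atTop h1).const_mul (A s)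
    simpa [hsM] using h2

open Filter Topology Asymptotics in
theorem gp_lead_zero (S : Finset ℝ) (A : ℝ → ℝ) (M : ℝ) (hM : M ∈ S) (hle : ∀ s ∈ S, M ≤ s) :
    Tendsto (fun z : ℝ => ∑ s ∈ S, A s * z ^ (s - M)) (𝓝[>] 0) (𝓝 (A M)) := by
  have hc : Continuous (fun z : ℝ => ∑ s ∈ S, A s * z ^ (s - M)) := by
    refine continuous_finsetSum _ fun s hs => ?_
    exact continuous_const.mul (continuous_id.rpow_const fun x => Or.inr (sub_nonneg.2 (hle s hs)))
  have h := (hc.tendsto 0).mono_left (nhdsWithin_le_nhds (s := Set.Ioi 0))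
  have h2 : ∑ s ∈ S, A s * (0:ℝ) ^ (s - M) = A M := by
    rw [Finset.sum_eq_single M]
    · simp
    · intro s _ hs
      rw [Real.zero_rpow (sub_ne_zero.2 hs), mul_zero]
    · exact fun h => (h hM).elim
  rwa [h2] at h

open Filter Topology in
theorem gp_dichotomy {m : ℕ} (a b : Fin m → ℝ) (hb : ∀ k, 0 ≤ b k) :
    (∀ z : ℝ, ∑ k, a k * z ^ (b k) = 0) ∨
    ((∃ c > 0, ∀ᶠ z : ℝ in atTop, c ≤ |∑ k, a k * z ^ (b k)|) ∧
     (∃ c > 0, ∃ β : ℝ, ∀ᶠ z : ℝ in 𝓝[>] 0, c * z ^ β ≤ |∑ k, a k * z ^ (b k)|)) := by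
  classical
  set A : ℝ → ℝ := fun s => ∑ k ∈ Finset.univ.filter (fun k => b k = s), a k with hA
  set S : Finset ℝ := (Finset.univ.image b).filter (fun s => A s ≠ 0) with hS
  have hF : ∀ z : ℝ, ∑ k, a k * z ^ (b k) = ∑ s ∈ S, A s * z ^ s := by
    intro z
    rw [hS, Finset.sum_filter_of_ne (fun s _ h => left_ne_zero_of_mul h)]
    rw [← Finset.sum_fiberwise_of_maps_to (s := Finset.univ) (t := Finset.univ.image b) (g := b)
      (fun k _ => Finset.mem_image_of_mem b (Finset.mem_univ k))]
    refine Finset.sum_congr rfl fun s _ => ?_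
    rw [hA, Finset.sum_mul]
    refine Finset.sum_congr rfl fun k hk => ?_
    rw [(Finset.mem_filter.1 hk).2]
  have hfac : ∀ M z : ℝ, 0 < z →
      ∑ k, a k * z ^ (b k) = z ^ M * ∑ s ∈ S, A s * z ^ (s - M) := by
    intro M z hz
    rw [hF, Finset.mul_sum]
    refine Finset.sum_congr rfl fun s _ => ?_
    rw [Real.rpow_sub hz]
    have := (Real.rpow_pos_of_pos hz M).ne'
    field_simp
  have key : ∀ (l : Filter ℝ) (M : ℝ), M ∈ S → (∀ᶠ z in l, 0 < z) →
      Tendsto (fun z : ℝ => ∑ s ∈ S, A s * z ^ (s - M)) l (𝓝 (A M)) →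
      ∀ᶠ z in l, |A M| / 2 * z ^ M ≤ |∑ k, a k * z ^ (b k)| := by
    intro l M hM hl ht
    have hAM : 0 < |A M| := abs_pos.2 (Finset.mem_filter.1 hM).2
    have h1 := ht.abs.eventually (lt_mem_nhds (half_lt_self hAM))
    filter_upwards [h1, hl] with z h1 hz
    rw [hfac M z hz, abs_mul, abs_of_pos (Real.rpow_pos_of_pos hz M), mul_comm]
    have := Real.rpow_pos_of_pos hz M
    gcongr
  rcases S.eq_empty_or_nonempty with h0 | hne
  · left
    intro z
    rw [hF, h0, Finset.sum_empty]
  · right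
    constructor
    · have hM := S.max'_mem hne
      have hAM : 0 < |A (S.max' hne)| := abs_pos.2 (Finset.mem_filter.1 hM).2
      refine ⟨|A (S.max' hne)| / 2, by positivity, ?_⟩
      have h := key atTop _ hM (eventually_gt_atTop 0)
        (gp_lead_top S A _ hM fun s hs => S.le_max' s hs)
      have hM0 : 0 ≤ S.max' hne := by
        obtain ⟨k, -, hk⟩ := Finset.mem_image.1 (Finset.mem_filter.1 hM).1
        rw [← hk]; exact hb k
      filter_upwards [h, eventually_ge_atTop 1] with z h1 h2
      refine le_trans ?_ h1
      exact le_mul_of_one_le_right (by positivity) (Real.one_le_rpow h2 hM0)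
    · have hM := S.min'_mem hne
      have hAM : 0 < |A (S.min' hne)| := abs_pos.2 (Finset.mem_filter.1 hM).2
      refine ⟨|A (S.min' hne)| / 2, by positivity, S.min' hne, ?_⟩
      exact key _ _ hM self_mem_nhdsWithin
        (gp_lead_zero S A _ hM fun s hs => S.min'_le s hs)

theorem gp_continuous {m : ℕ} (a b : Fin m → ℝ) (hb : ∀ k, 0 ≤ b k) :
    Continuous (fun z : ℝ => ∑ k, a k * z ^ (b k)) := by
  refine continuous_finsetSum _ fun s hs => ?_
  exact continuous_const.mul (continuous_id.rpow_const fun x => Or.inr (hb s))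

theorem gp_analyticAt {m : ℕ} (a b : Fin m → ℝ) (x : ℝ) (hx : 0 < x) :
    AnalyticAt ℝ (fun z : ℝ => ∑ k, a k * z ^ (b k)) x := by
  refine Finset.analyticAt_fun_sum _ fun k _ => ?_
  refine analyticAt_const.mul ?_
  have h : AnalyticAt ℝ (fun z : ℝ => Real.exp (Real.log z * b k)) x := by
    exact (((analyticAt_id).log hx).mul analyticAt_const).rexp
  refine h.congr ?_
  filter_upwards [lt_mem_nhds hx] with z hz
  rw [Real.rpow_def_of_pos hz]

open Filter Topology Asymptotics in
theorem gp_isBigO {m : ℕ} (a b : Fin m → ℝ) :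
    (fun z : ℝ => ∑ k, a k * z ^ (b k)) =O[atTop] Real.exp := by
  refine IsBigO.fun_sum fun k _ => ?_
  exact ((isLittleO_rpow_exp_atTop (b k)).isBigO).const_mul_left _

theorem abs_log_le_bound {c x : ℝ} (hc : 0 < c) (h : c ≤ |x|) : |Real.log x| ≤ |x| + 1 / c := by
  have hx : 0 < |x| := hc.trans_le h
  rw [← Real.log_abs x, abs_le]
  have h1 := Real.log_le_sub_one_of_pos hx
  have h2 := Real.log_le_sub_one_of_pos (inv_pos.2 hx)
  rw [Real.log_inv] at h2
  have h3 : |x|⁻¹ ≤ 1 / c := by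
    rw [one_div]; exact inv_anti₀ hc h
  have : 0 < 1 / c := by positivity
  constructor <;> linarith

open Filter Topology Asymptotics in
theorem log_isBigO_exp (F : ℝ → ℝ) (hF : F =O[atTop] Real.exp) {c : ℝ} (hc : 0 < c)
    (h : ∀ᶠ z in atTop, c ≤ |F z|) : (fun z => Real.log (F z)) =O[atTop] Real.exp := by
  have h1 : (fun z => |F z| + 1 / c) =O[atTop] Real.exp := by
    refine hF.abs_left.add ?_
    refine (isLittleO_const_left.2 (Or.inr ?_)).isBigO
    exact tendsto_norm_atTop_atTop.comp Real.tendsto_exp_atTop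
  refine IsBigO.trans ?_ h1
  refine IsBigO.of_bound 1 ?_
  filter_upwards [h] with z hz
  rw [Real.norm_eq_abs, Real.norm_eq_abs, one_mul]
  exact (abs_log_le_bound hc hz).trans (le_abs_self _)

open Filter Topology Asymptotics in
theorem gp_log_isBigO {m : ℕ} (a b : Fin m → ℝ) (hb : ∀ k, 0 ≤ b k) :
    (fun z : ℝ => Real.log (∑ k, a k * z ^ (b k))) =O[atTop] Real.exp := by
  rcases gp_dichotomy a b hb with h | ⟨⟨c, hc, h⟩, -⟩
  · simp only [h, Real.log_zero]
    exact isBigO_zero _ _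
  · exact log_isBigO_exp _ (gp_isBigO a b) hc h

open Filter Topology Asymptotics in
theorem gp_log_locInt {m : ℕ} (a b : Fin m → ℝ) (hb : ∀ k, 0 ≤ b k) :
    LocallyIntegrableOn (fun z : ℝ => Real.log (∑ k, a k * z ^ (b k))) (Set.Ici 0) := by
  intro x hx
  have hcont := gp_continuous a b hb
  rcases (Set.mem_Ici.1 hx).eq_or_lt with rfl | hx
  · rcases gp_dichotomy a b hb with h | ⟨-, ⟨c, hc, β, h⟩⟩
    · simp only [h, Real.log_zero]
      exact (integrable_zero _ _ _).integrableAtFilter _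
    · obtain ⟨δ, hδ, hsub⟩ := (mem_nhdsGT_iff_exists_Ioc_subset).1 h
      have hδ0 : (0:ℝ) < δ := hδ
      obtain ⟨B, hB⟩ := (isCompact_Icc (a := (0:ℝ)) (b := δ)).exists_bound_of_continuousOn
        hcont.continuousOn
      refine ⟨Set.Icc 0 δ, Icc_mem_nhdsGE hδ0, ?_⟩
      rw [integrableOn_Icc_iff_integrableOn_Ioc]
      have hlog : IntegrableOn Real.log (Set.Ioc 0 δ) :=
        (intervalIntegrable_iff_integrableOn_Ioc_of_le hδ0.le).1
          intervalIntegral.intervalIntegrable_log'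
      have hg : IntegrableOn (fun z => |Real.log c| + |β| * |Real.log z| + |B|) (Set.Ioc 0 δ) := by
        refine Integrable.add (Integrable.add ?_ ?_) ?_
        · exact integrableOn_const (by simp)
        · exact (hlog.abs).const_mul _
        · exact integrableOn_const (by simp)
      refine Integrable.mono' hg ?_ ?_
      · exact (Real.measurable_log.comp hcont.measurable).aestronglyMeasurable
      · refine (ae_restrict_iff' measurableSet_Ioc).2 (ae_of_all _ fun z hz => ?_)
        have h1 : c * z ^ β ≤ |∑ k, a k * z ^ (b k)| := hsub hz
        have h2 := hB z ⟨hz.1.le, hz.2⟩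
        rw [Real.norm_eq_abs] at h2 ⊢
        have hzb := Real.rpow_pos_of_pos hz.1 β
        have h3 := Real.log_le_log (by positivity) h1
        rw [Real.log_mul hc.ne' hzb.ne', Real.log_rpow hz.1] at h3
        have h4 := Real.log_le_sub_one_of_pos (lt_of_lt_of_le (by positivity) h1)
        rw [Real.log_abs] at h3 h4
        have h5 := abs_nonneg (Real.log c)
        have h6 := neg_abs_le (Real.log c)
        have h7 := neg_abs_le (β * Real.log z)
        have h8 := abs_nonneg (β * Real.log z)
        have h9 := le_abs_self B
        rw [abs_mul] at h7 h8
        rw [abs_le]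
        have h10 := abs_nonneg B
        constructor <;> linarith
  · have hm : MeromorphicOn (fun z : ℝ => ∑ k, a k * z ^ (b k)) (Set.uIcc (x/2) (2*x)) := by
      intro y hy
      rw [Set.uIcc_of_le (by linarith)] at hy
      exact (gp_analyticAt a b y (by linarith [hy.1])).meromorphicAt
    have h := hm.intervalIntegrable_log_norm
    simp only [Real.norm_eq_abs, Real.log_abs] at h
    rw [intervalIntegrable_iff_integrableOn_Ioo_of_le (by linarith)] at h
    exact ⟨_, mem_nhdsWithin_of_mem_nhds (Ioo_mem_nhds (by linarith) (by linarith)), h⟩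

open Filter Topology Asymptotics in
theorem gauss_isBigO {c : ℝ} (hc : 0 < c) (d : ℝ) :
    (fun s : ℝ => Real.exp (-c * (s + d) ^ 2)) =O[atTop] (fun s => Real.exp (-3 * s)) := by
  refine IsBigO.of_bound (Real.exp (9 / (4 * c) - 3 * d)) (Eventually.of_forall fun s => ?_)
  rw [Real.norm_eq_abs, Real.norm_eq_abs, Real.abs_exp, Real.abs_exp, ← Real.exp_add]
  apply Real.exp_le_exp.2
  have h : 0 ≤ c * ((s + d) - 3 / (2 * c)) ^ 2 := by positivity
  have h2 : c * ((s + d) - 3 / (2 * c)) ^ 2 = c * (s + d) ^ 2 - 3 * (s + d) + 9 / (4 * c) := by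
    field_simp
    ring
  linarith

open Filter Topology Asymptotics in
theorem weighted_integrableOn {c : ℝ} (hc : 0 < c) (d : ℝ) (W L : ℝ → ℝ)
    (hW : Continuous W) (hWO : W =O[atTop] Real.exp)
    (hL : LocallyIntegrableOn L (Set.Ici 0)) (hLO : L =O[atTop] Real.exp) :
    IntegrableOn (fun s => Real.exp (-c * (s + d) ^ 2) * (W s * L s)) (Set.Ici 0) := by
  refine LocallyIntegrableOn.integrableOn_of_isBigO_atTop (g := fun s => Real.exp (-s)) ?_ ?_ ?_
  · have h := hL.continuousOn_mul (g := fun s => Real.exp (-c * (s + d) ^ 2) * W s)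
      (by fun_prop) isClosed_Ici.isLocallyClosed
    simpa only [mul_assoc] using h
  · have h := (gauss_isBigO hc d).mul (hWO.mul hLO)
    refine h.congr_right fun s => ?_
    rw [← Real.exp_add, ← Real.exp_add]
    ring_nf
  · exact ⟨Set.Ioi 0, Ioi_mem_atTop 0, integrableOn_exp_neg_Ioi 0⟩

theorem isBigO_const_exp (c : ℝ) :
    (fun _ : ℝ => c) =O[Filter.atTop] Real.exp :=
  (Asymptotics.isLittleO_const_left.2
    (Or.inr (tendsto_norm_atTop_atTop.comp Real.tendsto_exp_atTop))).isBigO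

open Filter Topology Asymptotics in
theorem left_integrableOn {m : ℕ} (a b : Fin m → ℝ) (hb : ∀ k, 0 ≤ b k) (F : ℝ → ℝ)
    (hF : F = fun z => ∑ k, a k * z ^ (b k))
    (hFnn : ∀ z, 0 ≤ z → 0 ≤ F z) {c p : ℝ} (hc : 0 < c) (hp : 0 < p) (d : ℝ) :
    IntegrableOn (fun s => Real.exp (-c * (s + d) ^ 2) *
      ((p + (s + F s)) * Real.log ((p + (s + F s)) / F s))) (Set.Ici 0) := by
  have hFc : Continuous F := hF ▸ gp_continuous a b hb
  have hFO : F =O[atTop] Real.exp := hF ▸ gp_isBigO a b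
  have hlO : (fun z => Real.log (F z)) =O[atTop] Real.exp := by
    rw [hF]; exact gp_log_isBigO a b hb
  have hlI : LocallyIntegrableOn (fun z => Real.log (F z)) (Set.Ici 0) := by
    rw [hF]; exact gp_log_locInt a b hb
  have hidO : (fun s : ℝ => s) =O[atTop] Real.exp := by
    have := (isLittleO_rpow_exp_atTop 1).isBigO
    simpa using this
  have hWO : (fun s => p + (s + F s)) =O[atTop] Real.exp :=
    (isBigO_const_exp p).add (hidO.add hFO)
  have hWpos : ∀ s, 0 ≤ s → p ≤ p + (s + F s) := fun s hs => by linarith [hFnn s hs]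
  have hlWO : (fun s => Real.log (p + (s + F s))) =O[atTop] Real.exp := by
    refine log_isBigO_exp _ hWO hp ?_
    filter_upwards [eventually_ge_atTop 0] with s hs
    exact (hWpos s hs).trans (le_abs_self _)
  have hlWI : LocallyIntegrableOn (fun s => Real.log (p + (s + F s))) (Set.Ici 0) := by
    refine ContinuousOn.locallyIntegrableOn ?_ measurableSet_Ici
    refine ContinuousOn.log (by fun_prop) fun s hs => ?_
    exact (hp.trans_le (hWpos s hs)).ne'
  have key := weighted_integrableOn hc d (fun s => p + (s + F s)) _ (by fun_prop) hWO
    (hlWI.sub hlI) (hlWO.sub hlO)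
  refine Integrable.mono key ?_ ?_
  · have : Measurable F := hFc.measurable
    exact Measurable.aestronglyMeasurable (by fun_prop)
  · refine (ae_restrict_iff' measurableSet_Ici).2 (ae_of_all _ fun s hs => ?_)
    by_cases h0 : F s = 0
    · rw [h0, div_zero, Real.log_zero, mul_zero, mul_zero, norm_zero]
      exact norm_nonneg _
    · rw [Real.log_div (hp.trans_le (hWpos s hs)).ne' h0]
      rfl

open Filter Topology Asymptotics in
theorem right_integrableOn {c p : ℝ} (hc : 0 < c) (hp : 0 < p) (d : ℝ) :
    IntegrableOn (fun s => Real.exp (-c * (s + d) ^ 2) *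
      (p * Real.log (p / s))) (Set.Ioi 0) := by
  have hidO : (fun s : ℝ => s) =O[atTop] Real.exp := by
    have := (isLittleO_rpow_exp_atTop 1).isBigO
    simpa using this
  have hlO : (fun z : ℝ => Real.log z) =O[atTop] Real.exp := by
    refine log_isBigO_exp _ hidO one_pos ?_
    filter_upwards [eventually_ge_atTop 1] with s hs
    exact hs.trans (le_abs_self _)
  have hlI : LocallyIntegrableOn Real.log (Set.Ici 0) := by
    intro x _
    have h := (intervalIntegrable_iff_integrableOn_Ioo_of_le (by linarith)).1
      (intervalIntegral.intervalIntegrable_log' (a := x - 1) (b := x + 1))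
    exact ⟨_, mem_nhdsWithin_of_mem_nhds (Ioo_mem_nhds (by linarith) (by linarith)), h⟩
  have hcI : LocallyIntegrableOn (fun _ : ℝ => Real.log p) (Set.Ici 0) :=
    continuousOn_const.locallyIntegrableOn measurableSet_Ici
  have key := weighted_integrableOn hc d (fun s => p) _ (by fun_prop) (isBigO_const_exp p)
    (hcI.sub hlI) ((isBigO_const_exp (Real.log p)).sub hlO)
  refine (key.mono_set Set.Ioi_subset_Ici_self).congr_fun ?_ measurableSet_Ioi
  intro s hs
  have : s ≠ 0 := ne_of_gt hs
  simp only [Pi.sub_apply]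
  rw [Real.log_div hp.ne' this]

theorem sKL_integrable {m : ℕ} (a b : Fin m → ℝ) (hb : ∀ k, 0 ≤ b k) (f : ℝ → ℝ)
    (hfdef : ∀ z : ℝ, 0 ≤ z → f z = ∑ k, a k * z ^ (b k))
    (hfnn : ∀ z : ℝ, 0 ≤ z → 0 ≤ f z) {p σ : ℝ} (hp : 0 < p) (q : ℝ) (hσ : 0 < σ) :
    Integrable (fun t : ℝ => sKLIntegrand p q f σ t) := by
  have hc : 0 < 1 / (2 * σ ^ 2) := by positivity
  suffices h : Integrable (fun s : ℝ => sKLIntegrand p q f σ (s - q)) by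
    have := h.comp_add_right q
    simpa using this
  rw [← integrableOn_univ, ← Set.Iic_union_Ioi (a := (0:ℝ))]
  refine IntegrableOn.union ?_ ?_
  · have h := left_integrableOn a b hb _ rfl (fun z hz => by
      have := hfnn z hz
      rwa [hfdef z hz] at this) hc hp q
    have h2 := IntegrableOn.comp_neg_Iic (c := (0:ℝ)) (by rw [neg_zero]; exact h)
    refine h2.congr_fun ?_ measurableSet_Iic
    intro s hs
    have hs : s ≤ 0 := hs
    have e1 : q + (s - q) = s := by ring
    simp only [sKLIntegrand, dynShift, e1, not_lt.2 hs, if_false, abs_of_nonpos hs]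
    rw [hfdef (-s) (by linarith)]
    have e2 : -(1 / (2 * σ ^ 2)) * (-s + q) ^ 2 = -(s - q) ^ 2 / (2 * σ ^ 2) := by
      field_simp
      ring
    have e3 : s + (-s + ∑ k, a k * (-s) ^ (b k)) = ∑ k, a k * (-s) ^ (b k) := by ring
    rw [e2, e3]
  · have h := right_integrableOn hc hp (-q)
    refine h.congr_fun ?_ measurableSet_Ioi
    intro s hs
    have hs : 0 < s := hs
    have e1 : q + (s - q) = s := by ring
    simp only [sKLIntegrand, dynShift, e1, hs, if_true, add_zero]
    congr 2
    field_simp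
    ring

open Filter Topology in
theorem sKL_tendsto (f : ℝ → ℝ) {p q : ℝ} (hp : 0 < p) (hq : 0 < q)
    (hI : Integrable (fun t : ℝ => sKLIntegrand p q f 1 t)) :
    Tendsto (fun σ : ℝ => (1 / Real.sqrt (2 * Real.pi * σ ^ 2)) * ∫ t : ℝ, sKLIntegrand p q f σ t)
      (𝓝[>] 0) (𝓝 (p * Real.log (p / q))) := by
  set φ : ℝ → ℝ := fun x => (1 / Real.sqrt (2 * Real.pi)) * Real.exp (-(1/2) * x ^ 2) with hφ
  have hcont : ContinuousAt (fun t : ℝ => sKLIntegrand p q f 1 t) 0 := by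
    have hc : ContinuousAt (fun t : ℝ => Real.exp (-t ^ 2 / (2 * 1 ^ 2)) *
        (p * Real.log (p / (q + t)))) 0 := by
      refine ContinuousAt.mul (by fun_prop) (continuousAt_const.mul ?_)
      refine ContinuousAt.log ?_ ?_
      · exact continuousAt_const.div (by fun_prop) (by simpa using hq.ne')
      · simpa using ⟨hp.ne', hq.ne'⟩
    refine hc.congr ?_
    filter_upwards [lt_mem_nhds (neg_lt_zero.2 hq)] with t ht
    have : 0 < q + t := by linarith
    simp [sKLIntegrand, dynShift, this]
  have h0 : sKLIntegrand p q f 1 0 = p * Real.log (p / q) := by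
    simp [sKLIntegrand, dynShift, hq]
  have hpi : 0 < Real.sqrt (2 * Real.pi) := by positivity
  have h1 : ∫ x, φ x = 1 := by
    rw [hφ, integral_const_mul, integral_gaussian]
    rw [show Real.pi / (1/2) = 2 * Real.pi by ring]
    field_simp
  have hlim : Tendsto (fun x : ℝ => ‖x‖ ^ Module.finrank ℝ ℝ * φ x)
      (Bornology.cobounded ℝ) (𝓝 0) := by
    have h := (rpow_mul_exp_neg_mul_sq_isLittleO_exp_neg (b := 1/2) (by norm_num) 1).trans_tendsto
      (Real.tendsto_exp_atBot.comp (tendsto_id.const_mul_atTop_of_neg (by norm_num : -(1/2:ℝ) < 0)))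
    have h2 := (h.comp (tendsto_norm_cobounded_atTop (E := ℝ))).const_mul (1 / Real.sqrt (2 * Real.pi))
    rw [mul_zero] at h2
    refine h2.congr fun x => ?_
    simp [hφ]
    ring
  have key := tendsto_integral_comp_smul_smul_of_integrable (μ := volume) (φ := φ)
    (fun x => by positivity) h1 hlim hI hcont
  rw [h0] at key
  have hct : Tendsto (fun σ : ℝ => Real.sqrt ((σ⁻¹) ^ 2 - 1)) (𝓝[>] 0) atTop := by
    refine Real.tendsto_sqrt_atTop.comp ?_
    exact tendsto_atTop_add_const_right _ (-1)
      ((tendsto_pow_atTop two_ne_zero).comp tendsto_inv_nhdsGT_zero)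
  have k2 := key.comp hct
  have hr : Tendsto (fun σ : ℝ => 1 / Real.sqrt (1 - σ ^ 2)) (𝓝[>] 0) (𝓝 1) := by
    have : ContinuousAt (fun σ : ℝ => 1 / Real.sqrt (1 - σ ^ 2)) 0 := by
      refine continuousAt_const.div (by fun_prop) (by simp)
    have h := this.tendsto.mono_left (nhdsWithin_le_nhds (s := Set.Ioi 0))
    simpa using h
  have k3 := hr.mul k2
  rw [one_mul] at k3
  refine k3.congr' ?_
  filter_upwards [Ioo_mem_nhdsGT (zero_lt_one' ℝ)] with σ hσ
  obtain ⟨hσ0, hσ1⟩ := hσ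
  have hs1 : 0 < 1 - σ ^ 2 := by nlinarith
  have hss : 0 < Real.sqrt (1 - σ ^ 2) := Real.sqrt_pos.2 hs1
  have hnn : 0 ≤ (σ⁻¹) ^ 2 - 1 := by
    have : (σ⁻¹) ^ 2 - 1 = (1 - σ ^ 2) / σ ^ 2 := by field_simp
    rw [this]; positivity
  have hsq : Real.sqrt ((σ⁻¹) ^ 2 - 1) = Real.sqrt (1 - σ ^ 2) / σ := by
    have : (σ⁻¹) ^ 2 - 1 = (1 - σ ^ 2) / σ ^ 2 := by field_simp
    rw [this, Real.sqrt_div hs1.le, Real.sqrt_sq hσ0.le]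
  have hden : Real.sqrt (2 * Real.pi * σ ^ 2) = Real.sqrt (2 * Real.pi) * σ := by
    rw [Real.sqrt_mul (by positivity), Real.sqrt_sq hσ0.le]
  simp only [Function.comp, Module.finrank_self, pow_one, smul_eq_mul]
  rw [← integral_const_mul, ← integral_const_mul]
  refine integral_congr_ae (ae_of_all _ fun t => ?_)
  simp only [hφ, sKLIntegrand]
  have hexp : Real.exp (-t ^ 2 / (2 * σ ^ 2)) =
      Real.exp (-(1/2) * (Real.sqrt ((σ⁻¹) ^ 2 - 1) * t) ^ 2) * Real.exp (-t ^ 2 / (2 * 1 ^ 2)) := by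
    rw [← Real.exp_add, mul_pow, Real.sq_sqrt hnn]
    congr 1
    field_simp
    ring
  rw [hexp, hden]
  generalize Real.exp (-(1/2) * (Real.sqrt ((σ⁻¹) ^ 2 - 1) * t) ^ 2) = E
  rw [hsq]
  field_simp

/-- For probability vectors `p, q` with `q_i > 0` whenever `p_i > 0`, and a
dynamic shift function `f` which is a nonnegative finite sum of power laws,
the Gaussian average of the sKL divergence exists and converges to the KL
divergence `D_KL(p‖q)` as `σ → 0⁺`. -/
theorem expectedSKL_tendsto_klDiv {n : ℕ} (p q : Fin n → ℝ)
    (hp0 : ∀ i, 0 ≤ p i) (hq0 : ∀ i, 0 ≤ q i)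
    (hp1 : ∑ i, p i = 1) (hq1 : ∑ i, q i = 1)
    (hpq : ∀ i, 0 < p i → 0 < q i)
    (m : ℕ) (hm : 1 ≤ m) (a b : Fin m → ℝ) (hb : ∀ k, 0 ≤ b k)
    (ha : ∃ k, a k ≠ 0) (f : ℝ → ℝ)
    (hfdef : ∀ z : ℝ, 0 ≤ z → f z = ∑ k, a k * z ^ (b k))
    (hfnn : ∀ z : ℝ, 0 ≤ z → 0 ≤ f z) :
    (∀ σ : ℝ, 0 < σ → ∀ i, 0 < p i →
      Integrable (fun t : ℝ => sKLIntegrand (p i) (q i) f σ t)) ∧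
    Filter.Tendsto (fun σ : ℝ => expectedSKL p q f σ)
      (nhdsWithin 0 (Set.Ioi 0)) (nhds (klDiv p q)) := by
  refine ⟨fun σ hσ i hi => sKL_integrable a b hb f hfdef hfnn hi (q i) hσ, ?_⟩
  unfold expectedSKL klDiv
  refine tendsto_finsetSum _ fun i hi => ?_
  have hpi := (Finset.mem_filter.1 hi).2
  exact sKL_tendsto f hpi (hpq i hpi) (sKL_integrable a b hb f hfdef hfnn hpi (q i) one_pos)
end

section
/- Let p > 0 and q > 0 be real numbers. For σ > 0, the function x ↦ e^{−x²/(2σ²)} p log(p/(q+x)) is integrable on the interval (−q, ∞), and the quantity I₂(σ) = (1/√(2πσ²)) ∫_{−q}^{∞} e^{−x²/(2σ²)} p log(p/(q+x)) dx satisfies: there exist C > 0 and σ₀ > 0 such that for all 0 < σ < σ₀, | I₂(σ) − p log(p/q) − σ² p/(2q²) | ≤ C σ⁴. -/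
open MeasureTheory

lemma aux_G_deriv (y : ℝ) (hy : -1 < y) :
    HasDerivAt (fun y : ℝ => -Real.log (1 + y) + y - y ^ 2 / 2 + y ^ 3 / 3) (y ^ 3 / (1 + y)) y := by
  have h0 : (1 + y) ≠ 0 := by linarith
  have h1 : HasDerivAt (fun y : ℝ => Real.log (1 + y)) (1 / (1 + y)) y :=
    ((hasDerivAt_id y).const_add 1).log h0
  have h2 := ((h1.neg.add (hasDerivAt_id y)).sub ((hasDerivAt_pow 2 y).div_const 2)).add
    ((hasDerivAt_pow 3 y).div_const 3)
  refine h2.congr_deriv ?_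
  field_simp
  push_cast
  ring

/-- A function on `(a, ∞)` whose derivative has the sign of `y` is minimal at `0`. -/
lemma aux_min (f f' : ℝ → ℝ) (a : ℝ) (h : ∀ y, a < y → HasDerivAt f (f' y) y)
    (hp : ∀ y, 0 < y → 0 ≤ f' y) (hn : ∀ y, a < y → y < 0 → f' y ≤ 0) (ha : a < 0)
    (y : ℝ) (hy : a < y) : f 0 ≤ f y := by
  rcases le_total 0 y with h0 | h0
  · have : MonotoneOn f (Set.Ici 0) := by
      apply monotoneOn_of_hasDerivWithinAt_nonneg (f' := f') (convex_Ici 0)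
      · intro z hz
        exact (h z (lt_of_lt_of_le ha hz)).continuousAt.continuousWithinAt
      · intro z hz
        rw [interior_Ici] at hz
        exact (h z (lt_trans ha hz)).hasDerivWithinAt
      · intro z hz
        rw [interior_Ici] at hz
        exact hp z hz
    exact this (Set.mem_Ici.2 le_rfl) h0 h0
  · have : AntitoneOn f (Set.Icc y 0) := by
      apply antitoneOn_of_hasDerivWithinAt_nonpos (f' := f') (convex_Icc y 0)
      · intro z hz
        exact (h z (lt_of_lt_of_le hy hz.1)).continuousAt.continuousWithinAt
      · intro z hz
        rw [interior_Icc] at hz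
        exact (h z (lt_trans hy hz.1)).hasDerivWithinAt
      · intro z hz
        rw [interior_Icc] at hz
        exact hn z (lt_trans hy hz.1) hz.2
    exact this ⟨le_rfl, h0⟩ ⟨h0, le_rfl⟩ h0

lemma aux_G_bound (y : ℝ) (hy : -(1 / 2) < y) :
    |-Real.log (1 + y) + y - y ^ 2 / 2 + y ^ 3 / 3| ≤ y ^ 4 / 2 := by
  have h1 := aux_min _ _ (-(1 / 2)) (fun y hy => aux_G_deriv y (by linarith))
    (fun y hy => by positivity)
    (fun y hy hy0 => by
      apply div_nonpos_of_nonpos_of_nonneg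
      · exact (Odd.pow_neg (by decide) hy0).le
      · linarith) (by norm_num) y hy
  have h2 := aux_min
    (fun y => y ^ 4 / 2 - (-Real.log (1 + y) + y - y ^ 2 / 2 + y ^ 3 / 3))
    (fun y => y ^ 3 * ((1 + 2 * y) / (1 + y))) (-(1 / 2))
    (fun y hy => by
      have := ((hasDerivAt_pow 4 y).div_const 2).sub (aux_G_deriv y (by linarith))
      refine this.congr_deriv ?_
      have h0 : (1 + y) ≠ 0 := by linarith
      field_simp
      push_cast
      ring)
    (fun y hy => by positivity)
    (fun y hy hy0 => by
      apply mul_nonpos_of_nonpos_of_nonneg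
      · exact (Odd.pow_neg (by decide) hy0).le
      · apply div_nonneg <;> linarith) (by norm_num) y hy
  simp at h1 h2
  rw [abs_le]
  constructor
  · have : 0 ≤ y ^ 4 / 2 := by positivity
    linarith
  · linarith

lemma aux_int (σ : ℝ) (hσ : 0 < σ) (n : ℕ) :
    Integrable (fun x : ℝ => x ^ n * Real.exp (-x ^ 2 / (2 * σ ^ 2))) := by
  have := integrable_rpow_mul_exp_neg_mul_sq (b := 1 / (2 * σ ^ 2)) (by positivity) (s := n)
    (by have : (0:ℝ) ≤ n := n.cast_nonneg
        linarith)
  convert this using 3 with x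
  · simp
  · congr 1
    ring

lemma aux_exp_deriv (σ : ℝ) (hσ : 0 < σ) (x : ℝ) :
    HasDerivAt (fun x : ℝ => Real.exp (-x ^ 2 / (2 * σ ^ 2)))
      (-(x / σ ^ 2) * Real.exp (-x ^ 2 / (2 * σ ^ 2))) x := by
  have := ((hasDerivAt_pow 2 x).neg.div_const (2 * σ ^ 2)).exp
  convert this using 1
  simp only [Pi.neg_apply]
  rw [mul_comm]
  congr 1
  field_simp
  push_cast
  ring

lemma aux_M0 (σ : ℝ) (hσ : 0 < σ) :
    ∫ x : ℝ, Real.exp (-x ^ 2 / (2 * σ ^ 2)) = Real.sqrt (2 * Real.pi * σ ^ 2) := by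
  have := integral_gaussian (1 / (2 * σ ^ 2))
  have e : Real.pi / (1 / (2 * σ ^ 2)) = 2 * Real.pi * σ ^ 2 := by
    field_simp
  rw [e] at this
  rw [← this]
  congr 1
  ext x
  congr 1
  ring

lemma aux_M1 (σ : ℝ) (hσ : 0 < σ) :
    ∫ x : ℝ, x ^ 1 * Real.exp (-x ^ 2 / (2 * σ ^ 2)) = 0 := by
  have h := integral_eq_zero_of_hasDerivAt_of_integrable (aux_exp_deriv σ hσ)
    (by
      convert (aux_int σ hσ 1).const_mul (-(1 / σ ^ 2)) using 2 with x
      ring) (by simpa using aux_int σ hσ 0)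
  have e : (fun x : ℝ => -(x / σ ^ 2) * Real.exp (-x ^ 2 / (2 * σ ^ 2))) =
      fun x => (-(1 / σ ^ 2)) * (x ^ 1 * Real.exp (-x ^ 2 / (2 * σ ^ 2))) := by
    ext x; ring
  rw [e, integral_const_mul] at h
  rcases mul_eq_zero.1 h with h | h
  · exfalso
    have : 0 < 1 / σ ^ 2 := by positivity
    linarith
  · exact h

lemma aux_rec (σ : ℝ) (hσ : 0 < σ) (n : ℕ) :
    ∫ x : ℝ, x ^ (n + 2) * Real.exp (-x ^ 2 / (2 * σ ^ 2)) =
      σ ^ 2 * (n + 1) * ∫ x : ℝ, x ^ n * Real.exp (-x ^ 2 / (2 * σ ^ 2)) := by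
  have i1 := (aux_int σ hσ n).const_mul ((n : ℝ) + 1)
  have i2 := (aux_int σ hσ (n + 2)).const_mul (1 / σ ^ 2)
  have h := integral_eq_zero_of_hasDerivAt_of_integrable
    (f := fun x : ℝ => x ^ (n + 1) * Real.exp (-x ^ 2 / (2 * σ ^ 2)))
    (f' := fun x : ℝ => ((n : ℝ) + 1) * (x ^ n * Real.exp (-x ^ 2 / (2 * σ ^ 2))) -
      1 / σ ^ 2 * (x ^ (n + 2) * Real.exp (-x ^ 2 / (2 * σ ^ 2))))
    (fun x => by
      have := (hasDerivAt_pow (n + 1) x).mul (aux_exp_deriv σ hσ x)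
      refine this.congr_deriv ?_
      push_cast
      ring) (i1.sub i2) (aux_int σ hσ (n + 1))
  rw [integral_sub i1 i2, integral_const_mul, integral_const_mul] at h
  set a := ∫ x : ℝ, x ^ n * Real.exp (-x ^ 2 / (2 * σ ^ 2))
  set b := ∫ x : ℝ, x ^ (n + 2) * Real.exp (-x ^ 2 / (2 * σ ^ 2))
  field_simp at h
  linarith

lemma aux_M2 (σ : ℝ) (hσ : 0 < σ) :
    ∫ x : ℝ, x ^ 2 * Real.exp (-x ^ 2 / (2 * σ ^ 2)) =
      σ ^ 2 * Real.sqrt (2 * Real.pi * σ ^ 2) := by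
  have := aux_rec σ hσ 0
  simp only [pow_zero, one_mul, aux_M0 σ hσ] at this
  simpa using this

lemma aux_M3 (σ : ℝ) (hσ : 0 < σ) :
    ∫ x : ℝ, x ^ 3 * Real.exp (-x ^ 2 / (2 * σ ^ 2)) = 0 := by
  have := aux_rec σ hσ 1
  rw [aux_M1 σ hσ] at this
  simpa using this

lemma aux_M4 (σ : ℝ) (hσ : 0 < σ) :
    ∫ x : ℝ, x ^ 4 * Real.exp (-x ^ 2 / (2 * σ ^ 2)) =
      3 * σ ^ 4 * Real.sqrt (2 * Real.pi * σ ^ 2) := by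
  have := aux_rec σ hσ 2
  rw [aux_M2 σ hσ] at this
  rw [show (4 : ℕ) = 2 + 2 from rfl, this]
  push_cast
  ring

lemma aux_psi (q : ℝ) (hq : 0 < q) :
    Integrable ((Set.Ioc (-q) 0).indicator (fun x : ℝ => |Real.log (1 + x / q)|)) := by
  rw [integrable_indicator_iff measurableSet_Ioc,
    ← intervalIntegrable_iff_integrableOn_Ioc_of_le (by linarith)]
  have h : IntervalIntegrable (fun x => Real.log (x + q)) volume (0 - q) (q - q) :=
    (intervalIntegral.intervalIntegrable_log' (a := 0) (b := q)).comp_add_right q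
  rw [zero_sub, sub_self] at h
  have h2 := (h.sub (intervalIntegrable_const (c := Real.log q))).abs
  refine h2.congr ?_
  intro x hx
  rw [Set.uIoc_of_le (by linarith)] at hx
  simp only
  rw [← Real.log_div (by linarith [hx.1]) hq.ne']
  congr 2
  field_simp
  ring

lemma aux_exp_small (σ q x : ℝ) (hσ : 0 < σ) (hq : 0 < q) (hx : x / q ≤ -(1 / 2)) :
    Real.exp (-x ^ 2 / (2 * σ ^ 2)) ≤ 3072 / q ^ 6 * σ ^ 6 := by
  rw [div_le_iff₀ hq] at hx
  have h1 := Real.pow_div_factorial_le_exp (x := q ^ 2 / (8 * σ ^ 2)) (by positivity) 3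
  have h2 : Real.exp (-x ^ 2 / (2 * σ ^ 2)) ≤ Real.exp (-(q ^ 2 / (8 * σ ^ 2))) := by
    apply Real.exp_le_exp.2
    have : q ^ 2 / 4 ≤ x ^ 2 := by nlinarith
    have h3 : q ^ 2 / (8 * σ ^ 2) = (q ^ 2 / 4) / (2 * σ ^ 2) := by field_simp; norm_num
    rw [h3, neg_div]
    apply neg_le_neg
    gcongr
  refine h2.trans ?_
  rw [Real.exp_neg]
  have h4 : (q ^ 2 / (8 * σ ^ 2)) ^ 3 / ((3).factorial : ℝ) = (3072 / q ^ 6 * σ ^ 6)⁻¹ := by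
    have : ((Nat.factorial 3 : ℕ) : ℝ) = 6 := by norm_num [Nat.factorial]
    rw [this]
    field_simp
    norm_num
  rw [h4] at h1
  exact inv_le_of_inv_le₀ (by positivity) h1

lemma aux_R (L y : ℝ) (hy : -1 < y) :
    |(L - Real.log (1 + y)) - (L - y + y ^ 2 / 2 - y ^ 3 / 3)| ≤
      (|L| + 11) * y ^ 4 + (if y ≤ -(1 / 2) then |Real.log (1 + y)| else 0) := by
  have e : (L - Real.log (1 + y)) - (L - y + y ^ 2 / 2 - y ^ 3 / 3) =
    -Real.log (1 + y) + y - y ^ 2 / 2 + y ^ 3 / 3 := by ring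
  rw [e]
  have hL := abs_nonneg L
  have h4 : 0 ≤ y ^ 4 := by positivity
  have h5 : 0 ≤ |L| * y ^ 4 := by positivity
  split_ifs with h
  · have a1 : |-Real.log (1 + y) + y - y ^ 2 / 2 + y ^ 3 / 3| ≤
      |-Real.log (1 + y)| + |y - y ^ 2 / 2 + y ^ 3 / 3| := by
      have := abs_add_le (-Real.log (1 + y)) (y - y ^ 2 / 2 + y ^ 3 / 3)
      rwa [← add_assoc, ← add_sub_assoc] at this
    rw [abs_neg] at a1
    have a2 : |y - y ^ 2 / 2 + y ^ 3 / 3| ≤ 11 * y ^ 4 := by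
      have b1 : 1 / 4 ≤ y ^ 2 := by nlinarith
      have b2 : 1 / 16 ≤ y ^ 4 := by nlinarith
      have b3 : y ^ 2 ≤ 1 := by nlinarith
      have b4 : y ^ 2 ≤ 4 * y ^ 4 := by nlinarith
      have b5 : -y ≤ 2 * y ^ 2 := by nlinarith
      have b6 : -y ^ 3 ≤ 2 * y ^ 4 := by nlinarith [mul_nonneg (sub_nonneg.2 b5) (sq_nonneg y)]
      have b7 : 0 ≤ -y ^ 3 := by nlinarith
      rw [abs_le]
      constructor <;> linarith
    linarith
  · have := aux_G_bound y (by linarith)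
    linarith

lemma aux_T (L y : ℝ) (hy : y ≤ -1) :
    |0 - (L - y + y ^ 2 / 2 - y ^ 3 / 3)| ≤ (|L| + 11) * y ^ 4 := by
  have b1 : 1 ≤ y ^ 2 := by nlinarith
  have b4 : y ^ 2 ≤ y ^ 4 := by nlinarith
  have b5 : -y ≤ y ^ 2 := by nlinarith
  have b6 : -y ^ 3 ≤ y ^ 4 := by nlinarith [mul_nonneg (sub_nonneg.2 b5) (sq_nonneg y)]
  have b7 : 0 ≤ -y ^ 3 := by nlinarith
  have hL := abs_nonneg L
  have h5 : |L| ≤ |L| * y ^ 4 := by nlinarith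
  have c1 := le_abs_self L
  have c2 := neg_abs_le L
  rw [abs_le]
  constructor <;> linarith

/-- Indicator version of the integrand. -/
noncomputable def auxPhi (p q σ : ℝ) : ℝ → ℝ :=
  (Set.Ioi (-q)).indicator
    (fun x : ℝ => Real.exp (-x ^ 2 / (2 * σ ^ 2)) * (p * Real.log (p / (q + x))))

noncomputable def auxPsi (p q σ : ℝ) : ℝ → ℝ := fun x =>
  Real.exp (-x ^ 2 / (2 * σ ^ 2)) *
    (p * (Real.log (p / q) - x / q + (x / q) ^ 2 / 2 - (x / q) ^ 3 / 3))

noncomputable def auxD (p q σ : ℝ) : ℝ → ℝ := fun x =>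
  p * (|Real.log (p / q)| + 11) / q ^ 4 * (x ^ 4 * Real.exp (-x ^ 2 / (2 * σ ^ 2))) +
    p * (3072 / q ^ 6 * σ ^ 6) *
      (Set.Ioc (-q) 0).indicator (fun x : ℝ => |Real.log (1 + x / q)|) x

lemma aux_bound (p q σ : ℝ) (hp : 0 < p) (hq : 0 < q) (hσ : 0 < σ) (x : ℝ) :
    |auxPhi p q σ x - auxPsi p q σ x| ≤ auxD p q σ x := by
  unfold auxPhi auxPsi auxD
  have hE := Real.exp_pos (-x ^ 2 / (2 * σ ^ 2))
  have hind : 0 ≤ (Set.Ioc (-q) 0).indicator (fun x : ℝ => |Real.log (1 + x / q)|) x :=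
    Set.indicator_nonneg (fun _ _ => abs_nonneg _) _
  have hsm := aux_exp_small σ q x hσ hq
  set E := Real.exp (-x ^ 2 / (2 * σ ^ 2))
  set L := Real.log (p / q) with hL
  have e4 : p * (|L| + 11) / q ^ 4 * (x ^ 4 * E) = E * p * ((|L| + 11) * (x / q) ^ 4) := by
    field_simp
  rw [e4]
  by_cases hx : -q < x
  · rw [Set.indicator_of_mem (show x ∈ Set.Ioi (-q) from hx)]
    have hy : -1 < x / q := by rw [lt_div_iff₀ hq]; linarith
    have hl : Real.log (p / (q + x)) = L - Real.log (1 + x / q) := by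
      rw [hL, ← Real.log_div (by positivity) (by linarith)]
      congr 1
      have : q + x ≠ 0 := by linarith
      field_simp
    rw [hl]
    have h := aux_R L (x / q) hy
    rw [← mul_sub, ← mul_sub, abs_mul, abs_mul, abs_of_pos hE, abs_of_pos hp, ← mul_assoc]
    refine (mul_le_mul_of_nonneg_left h (by positivity)).trans ?_
    rw [mul_add]
    refine add_le_add le_rfl ?_
    split_ifs with hc
    · have hx0 : x ≤ 0 := by
        rw [div_le_iff₀ hq] at hc
        nlinarith
      rw [Set.indicator_of_mem (show x ∈ Set.Ioc (-q) 0 from ⟨hx, hx0⟩), mul_comm E p]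
      gcongr
      exact hsm hc
    · rw [mul_zero]; positivity
  · rw [Set.indicator_of_notMem (show x ∉ Set.Ioi (-q) from hx)]
    have hy : x / q ≤ -1 := by rw [div_le_iff₀ hq]; linarith
    have h := aux_T L (x / q) hy
    rw [zero_sub, abs_neg] at h ⊢
    rw [abs_mul, abs_mul, abs_of_pos hE, abs_of_pos hp, ← mul_assoc]
    have := mul_le_mul_of_nonneg_left h (show 0 ≤ E * p by positivity)
    have h2 : 0 ≤ p * (3072 / q ^ 6 * σ ^ 6) *
      (Set.Ioc (-q) 0).indicator (fun x : ℝ => |Real.log (1 + x / q)|) x := by positivity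
    linarith

lemma aux_D_int (p q σ : ℝ) (hq : 0 < q) (hσ : 0 < σ) : Integrable (auxD p q σ) :=
  ((aux_int σ hσ 4).const_mul _).add ((aux_psi q hq).const_mul _)

lemma aux_D_val (p q σ : ℝ) (hq : 0 < q) (hσ : 0 < σ) :
    ∫ x, auxD p q σ x = p * (|Real.log (p / q)| + 11) / q ^ 4 *
      (3 * σ ^ 4 * Real.sqrt (2 * Real.pi * σ ^ 2)) + p * (3072 / q ^ 6 * σ ^ 6) *
      ∫ x, (Set.Ioc (-q) 0).indicator (fun x : ℝ => |Real.log (1 + x / q)|) x := by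
  unfold auxD
  rw [integral_add ((aux_int σ hσ 4).const_mul _) ((aux_psi q hq).const_mul _),
    integral_const_mul, integral_const_mul, aux_M4 σ hσ]

lemma aux_Psi_eq (p q σ : ℝ) : auxPsi p q σ = fun x =>
    ((p * Real.log (p / q)) * (x ^ 0 * Real.exp (-x ^ 2 / (2 * σ ^ 2))) +
     (-p / q) * (x ^ 1 * Real.exp (-x ^ 2 / (2 * σ ^ 2)))) +
    ((p / (2 * q ^ 2)) * (x ^ 2 * Real.exp (-x ^ 2 / (2 * σ ^ 2))) +
     (-p / (3 * q ^ 3)) * (x ^ 3 * Real.exp (-x ^ 2 / (2 * σ ^ 2)))) := by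
  ext x
  unfold auxPsi
  ring

lemma aux_Psi_int (p q σ : ℝ) (hσ : 0 < σ) : Integrable (auxPsi p q σ) := by
  rw [aux_Psi_eq]
  exact (((aux_int σ hσ 0).const_mul _).add ((aux_int σ hσ 1).const_mul _)).add
    (((aux_int σ hσ 2).const_mul _).add ((aux_int σ hσ 3).const_mul _))

lemma aux_Psi_val (p q σ : ℝ) (hσ : 0 < σ) : ∫ x, auxPsi p q σ x =
    (p * Real.log (p / q) + σ ^ 2 * p / (2 * q ^ 2)) * Real.sqrt (2 * Real.pi * σ ^ 2) := by
  have i0 := ((aux_int σ hσ 0).const_mul (p * Real.log (p / q)))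
  have i1 := ((aux_int σ hσ 1).const_mul (-p / q))
  have i2 := ((aux_int σ hσ 2).const_mul (p / (2 * q ^ 2)))
  have i3 := ((aux_int σ hσ 3).const_mul (-p / (3 * q ^ 3)))
  have h0 : ∫ x : ℝ, x ^ 0 * Real.exp (-x ^ 2 / (2 * σ ^ 2)) =
      Real.sqrt (2 * Real.pi * σ ^ 2) := by
    simpa using aux_M0 σ hσ
  rw [aux_Psi_eq]
  have hadd := integral_add (i0.add i1) (i2.add i3)
  simp only [Pi.add_apply] at hadd
  rw [hadd, integral_add i0 i1, integral_add i2 i3,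
    integral_const_mul, integral_const_mul, integral_const_mul, integral_const_mul,
    h0, aux_M1 σ hσ, aux_M2 σ hσ, aux_M3 σ hσ]
  ring

lemma aux_diff_int (p q σ : ℝ) (hp : 0 < p) (hq : 0 < q) (hσ : 0 < σ) :
    Integrable (fun x => auxPhi p q σ x - auxPsi p q σ x) := by
  refine (aux_D_int p q σ hq hσ).mono' ?_ (Filter.Eventually.of_forall fun x => ?_)
  · apply Measurable.aestronglyMeasurable
    unfold auxPhi auxPsi
    apply Measurable.sub
    · apply Measurable.indicator _ measurableSet_Ioi
      fun_prop
    · fun_prop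
  · exact aux_bound p q σ hp hq hσ x

lemma aux_Phi_int (p q σ : ℝ) (hp : 0 < p) (hq : 0 < q) (hσ : 0 < σ) :
    Integrable (auxPhi p q σ) := by
  have := (aux_diff_int p q σ hp hq hσ).add (aux_Psi_int p q σ hσ)
  refine this.congr (Filter.Eventually.of_forall fun x => ?_)
  simp

/-- The Gaussian integral `I₂(σ)` over the region where the noisy entry `q + x`
is positive: the integrand is integrable on `(-q, ∞)`, and
`I₂(σ) = p log(p/q) + σ² p/(2q²) + O(σ⁴)` as `σ → 0⁺`. -/
theorem I2_asymptotics (p q : ℝ) (hp : 0 < p) (hq : 0 < q) :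
    (∀ σ : ℝ, 0 < σ →
      IntegrableOn
        (fun x : ℝ => Real.exp (-x ^ 2 / (2 * σ ^ 2)) * (p * Real.log (p / (q + x))))
        (Set.Ioi (-q))) ∧
    ∃ C > 0, ∃ σ₀ > 0, ∀ σ : ℝ, 0 < σ → σ < σ₀ →
      |(1 / Real.sqrt (2 * Real.pi * σ ^ 2)) *
            (∫ x in Set.Ioi (-q),
              Real.exp (-x ^ 2 / (2 * σ ^ 2)) * (p * Real.log (p / (q + x))))
          - p * Real.log (p / q) - σ ^ 2 * p / (2 * q ^ 2)|
        ≤ C * σ ^ 4 := by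
  refine ⟨fun σ hσ => ?_, ?_⟩
  · rw [← integrable_indicator_iff measurableSet_Ioi]
    exact aux_Phi_int p q σ hp hq hσ
  set A := ∫ x, (Set.Ioc (-q) 0).indicator (fun x : ℝ => |Real.log (1 + x / q)|) x with hA
  have hA0 : 0 ≤ A := integral_nonneg fun x =>
    Set.indicator_nonneg (fun _ _ => abs_nonneg _) _
  refine ⟨p * (|Real.log (p / q)| + 11) / q ^ 4 * 3 + p * (3072 / q ^ 6) * A, by positivity,
    1, one_pos, fun σ hσ hσ1 => ?_⟩
  rw [← integral_indicator measurableSet_Ioi]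
  change |1 / Real.sqrt (2 * Real.pi * σ ^ 2) * (∫ x, auxPhi p q σ x) - _ - _| ≤ _
  have hs : σ ≤ Real.sqrt (2 * Real.pi * σ ^ 2) := by
    apply Real.le_sqrt_of_sq_le
    nlinarith [Real.pi_gt_three, sq_nonneg σ]
  have hJ := aux_Psi_val p q σ hσ
  have hD := aux_D_val p q σ hq hσ
  rw [← hA] at hD
  have hd : |(∫ x, auxPhi p q σ x) - ∫ x, auxPsi p q σ x| ≤ ∫ x, auxD p q σ x := by
    rw [← integral_sub (aux_Phi_int p q σ hp hq hσ) (aux_Psi_int p q σ hσ)]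
    refine (abs_integral_le_integral_abs).trans ?_
    exact integral_mono (aux_diff_int p q σ hp hq hσ).abs (aux_D_int p q σ hq hσ)
      (aux_bound p q σ hp hq hσ)
  rw [hJ, hD] at hd
  set s := Real.sqrt (2 * Real.pi * σ ^ 2)
  have hs0 : 0 < s := lt_of_lt_of_le hσ hs
  set I := ∫ x, auxPhi p q σ x
  have e : 1 / s * I - p * Real.log (p / q) - σ ^ 2 * p / (2 * q ^ 2) =
      (I - (p * Real.log (p / q) + σ ^ 2 * p / (2 * q ^ 2)) * s) / s := by
    field_simp
    ring
  rw [e, abs_div, abs_of_pos hs0, div_le_iff₀ hs0]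
  refine hd.trans ?_
  have h6 : σ ^ 6 ≤ σ ^ 4 * s := by
    have : σ ^ 2 ≤ s := by nlinarith
    calc σ ^ 6 = σ ^ 4 * σ ^ 2 := by ring
      _ ≤ σ ^ 4 * s := by gcongr
  have h7 : p * (3072 / q ^ 6) * A * σ ^ 6 ≤ p * (3072 / q ^ 6) * A * (σ ^ 4 * s) := by gcongr
  linarith
end

section
/- Let p, q, σ, a, b > 0 be real numbers. Then the function z ↦ e^{−(q+z)²/(2σ²)} (p + z + a z^b) log((p + z + a z^b)/(a z^b)) is integrable on (0, ∞). -/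
open MeasureTheory

/-- For `p, q, σ, a, b > 0` and the shift function `f(z) = a z^b`, the integrand
of `I₁` is integrable on `(0, ∞)`. Here `z ^ b` is the real power. -/
theorem I1_integrand_integrable (p q σ a b : ℝ)
    (hp : 0 < p) (hq : 0 < q) (hσ : 0 < σ) (ha : 0 < a) (hb : 0 < b) :
    IntegrableOn
      (fun z : ℝ => Real.exp (-(q + z) ^ 2 / (2 * σ ^ 2)) *
        ((p + z + a * z ^ b) * Real.log ((p + z + a * z ^ b) / (a * z ^ b))))
      (Set.Ioi 0) := by
  obtain ⟨c, hc⟩ : ∃ c : ℝ, c = 1 / (2 * σ ^ 2) := ⟨_, rfl⟩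
  have hc0 : 0 < c := by rw [hc]; positivity
  obtain ⟨L, hL⟩ : ∃ L : ℝ, L = |Real.log a| := ⟨_, rfl⟩
  have I : ∀ k s : ℝ, -1 < s →
      IntegrableOn (fun z : ℝ => k * (z ^ s * Real.exp (-c * z ^ 2))) (Set.Ioi 0) :=
    fun k s hs => (integrableOn_rpow_mul_exp_neg_mul_sq hc0 hs).const_mul k
  have G := ((((((((((I (p ^ 2 + L * p) 0 (by norm_num)).add
    (I 1 2 (by norm_num))).add
    (I (a ^ 2) (b + b) (by linarith))).add
    (I (2 * p + L) 1 (by norm_num))).add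
    (I (2 * p * a + L * a) b (by linarith))).add
    (I (2 * a) (b + 1) (by linarith))).add
    (I (2 * b * p) (-(1 / 2)) (by norm_num))).add
    (I (2 * b) (1 + -(1 / 2)) (by norm_num))).add
    (I (2 * b * a) (b + -(1 / 2)) (by linarith))))
  refine Integrable.mono' G ?_ ?_
  · apply Measurable.aestronglyMeasurable
    fun_prop
  · refine (ae_restrict_iff' measurableSet_Ioi).mpr (Filter.Eventually.of_forall ?_)
    intro z hz
    have hz : 0 < z := hz
    simp only [Pi.add_apply]
    rw [Real.rpow_add hz b b, Real.rpow_add hz b 1, Real.rpow_add hz 1, Real.rpow_add hz b (-(1/2)),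
      Real.rpow_zero, Real.rpow_one, Real.rpow_two]
    have hx : 0 < z ^ b := Real.rpow_pos_of_pos hz b
    have hw : 0 < z ^ (-(1 / 2) : ℝ) := Real.rpow_pos_of_pos hz _
    have hlw : -Real.log z ≤ 2 * z ^ (-(1 / 2) : ℝ) := by
      have := Real.log_le_sub_one_of_pos hw
      rw [Real.log_rpow hz] at this
      linarith
    have hlx : Real.log (z ^ b) = b * Real.log z := Real.log_rpow hz b
    generalize z ^ b = x at *
    generalize z ^ (-(1 / 2) : ℝ) = w at *
    have hD : 0 < a * x := by positivity
    have hN : 0 < p + z + a * x := by positivity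
    have hl0 : 0 ≤ Real.log ((p + z + a * x) / (a * x)) := by
      apply Real.log_nonneg
      rw [le_div_iff₀ hD]
      linarith
    have hl1 : Real.log ((p + z + a * x) / (a * x)) ≤ (p + z + a * x) + L + 2 * b * w := by
      rw [Real.log_div hN.ne' hD.ne', Real.log_mul ha.ne' hx.ne', hlx]
      have h1 := Real.log_le_sub_one_of_pos hN
      have h2 := neg_abs_le (Real.log a)
      have h3 := mul_le_mul_of_nonneg_left hlw hb.le
      rw [hL]
      linarith
    have hE : Real.exp (-(q + z) ^ 2 / (2 * σ ^ 2)) ≤ Real.exp (-c * z ^ 2) := by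
      apply Real.exp_le_exp.mpr
      have : -(q + z) ^ 2 / (2 * σ ^ 2) = -c * (q + z) ^ 2 := by rw [hc]; ring
      rw [this]
      have : c * z ^ 2 ≤ c * (q + z) ^ 2 := by
        apply mul_le_mul_of_nonneg_left _ hc0.le
        nlinarith
      linarith
    rw [Real.norm_of_nonneg (by positivity)]
    calc _ ≤ Real.exp (-c * z ^ 2) * ((p + z + a * x) * ((p + z + a * x) + L + 2 * b * w)) := by
          gcongr
      _ = _ := by ring
end

section
/- Let p, q, a, b > 0 be real numbers, and for σ > 0 define I₁(σ) = (1/√(2πσ²)) ∫₀^∞ e^{−(q+z)²/(2σ²)} (p + z + a z^b) log((p + z + a z^b)/(a z^b)) dz. Then I₁(σ) goes to zero faster than any power of σ as σ → 0⁺: for every k ∈ ℕ, I₁(σ)/σ^k → 0 as σ → 0⁺. -/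
open MeasureTheory

lemma aux_three (x y w s : ℝ) (hx : 0 ≤ x) (hy : 0 ≤ y) (hw : 0 ≤ w) (hs : 0 ≤ s) :
    (x + y + w) ^ s ≤ 3 ^ s * (x ^ s + y ^ s + w ^ s) := by
  have h1 := Real.rpow_nonneg hx s
  have h2 := Real.rpow_nonneg hy s
  have h3 := Real.rpow_nonneg hw s
  have key : ∀ m : ℝ, 0 ≤ m → x ≤ m → y ≤ m → w ≤ m → m ^ s ≤ x ^ s + y ^ s + w ^ s →
      (x + y + w) ^ s ≤ 3 ^ s * (x ^ s + y ^ s + w ^ s) := by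
    intro m hm hxm hym hwm hms
    calc (x + y + w) ^ s ≤ (3 * m) ^ s :=
          Real.rpow_le_rpow (by positivity) (by linarith) hs
      _ = 3 ^ s * m ^ s := Real.mul_rpow (by norm_num) hm
      _ ≤ _ := by gcongr
  rcases le_total x y with hxy | hxy
  · rcases le_total y w with hyw | hyw
    · exact key w hw (by linarith) hyw le_rfl (by linarith)
    · exact key y hy hxy le_rfl hyw (by linarith)
  · rcases le_total x w with hyw | hyw
    · exact key w hw hyw (by linarith) le_rfl (by linarith)
    · exact key x hx le_rfl hxy hyw (by linarith)

lemma aux_nonneg (p a b z : ℝ) (hp : 0 < p) (ha : 0 < a) (hz : 0 < z) :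
    0 ≤ (p + z + a * z ^ b) * Real.log ((p + z + a * z ^ b) / (a * z ^ b)) := by
  have hzb : 0 < z ^ b := Real.rpow_pos_of_pos hz b
  refine mul_nonneg (by positivity) (Real.log_nonneg ?_)
  rw [le_div_iff₀ (by positivity)]
  linarith

lemma aux_bound_s8 (p a b z : ℝ) (hp : 0 < p) (ha : 0 < a) (hb : 0 < b) (hz : 0 < z) :
    (p + z + a * z ^ b) * Real.log ((p + z + a * z ^ b) / (a * z ^ b)) ≤
      (2 * b / a ^ (1 / (2 * b)) * 3 ^ (1 + 1 / (2 * b))) *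
        (p ^ (1 + 1 / (2 * b)) * z ^ (-(1 / 2) : ℝ) + z ^ (1 + 1 / (2 * b) - 1 / 2)
          + a ^ (1 + 1 / (2 * b)) * z ^ (b * (1 + 1 / (2 * b)) - 1 / 2)) := by
  have hzb : 0 < z ^ b := Real.rpow_pos_of_pos hz b
  set e := 1 / (2 * b) with he
  have hepos : 0 < e := by positivity
  set X := p + z + a * z ^ b with hX
  have hXpos : 0 < X := by positivity
  have hl := Real.log_le_rpow_div (x := X / (a * z ^ b)) (by positivity) hepos
  have h1 : (X / (a * z ^ b)) ^ e / e = 2 * b / a ^ e * X ^ e * z ^ (-(1 / 2) : ℝ) := by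
    rw [Real.div_rpow hXpos.le (by positivity), Real.mul_rpow ha.le hzb.le, ← Real.rpow_mul hz.le,
      Real.rpow_neg hz.le]
    have : b * e = 1 / 2 := by rw [he]; field_simp
    rw [this, he]
    field_simp
  have h2 := aux_three p z (a * z ^ b) (1 + e) hp.le hz.le (by positivity) (by positivity)
  rw [Real.mul_rpow ha.le hzb.le, ← Real.rpow_mul hz.le] at h2
  have hZ : 0 < z ^ (-(1 / 2) : ℝ) := Real.rpow_pos_of_pos hz _
  have hae : 0 < a ^ e := Real.rpow_pos_of_pos ha _
  calc X * Real.log (X / (a * z ^ b)) ≤ X * (2 * b / a ^ e * X ^ e * z ^ (-(1 / 2) : ℝ)) := by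
        rw [← h1]; gcongr
    _ = 2 * b / a ^ e * z ^ (-(1 / 2) : ℝ) * X ^ (1 + e) := by
        rw [Real.rpow_add hXpos, Real.rpow_one]; ring
    _ ≤ 2 * b / a ^ e * z ^ (-(1 / 2) : ℝ) *
        (3 ^ (1 + e) * (p ^ (1 + e) + z ^ (1 + e) + a ^ (1 + e) * z ^ (b * (1 + e)))) := by
        gcongr
    _ = _ := by
        rw [sub_eq_add_neg, sub_eq_add_neg, Real.rpow_add hz (1 + e), Real.rpow_add hz (b * (1 + e))]
        ring

lemma aux_int_s8 (p a b : ℝ) (hp : 0 < p) (ha : 0 < a) (hb : 0 < b) :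
    IntegrableOn (fun z : ℝ => Real.exp (-(1 / 2) * z ^ 2) *
      ((p + z + a * z ^ b) * Real.log ((p + z + a * z ^ b) / (a * z ^ b)))) (Set.Ioi 0) := by
  have hi : ∀ t : ℝ, -1 < t →
      IntegrableOn (fun z : ℝ => z ^ t * Real.exp (-(1 / 2) * z ^ 2)) (Set.Ioi 0) :=
    fun t ht => integrableOn_rpow_mul_exp_neg_mul_sq (by norm_num) ht
  have e1 := hi (-(1 / 2)) (by norm_num)
  have hepos : 0 < 1 / (2 * b) := by positivity
  have e2 := hi (1 + 1 / (2 * b) - 1 / 2) (by linarith)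
  have e3 := hi (b * (1 + 1 / (2 * b)) - 1 / 2) (by
    have : 0 < b * (1 + 1 / (2 * b)) := by positivity
    linarith)
  have hg := (((e1.const_mul (p ^ (1 + 1 / (2 * b)))).add e2).add
    (e3.const_mul (a ^ (1 + 1 / (2 * b))))).const_mul
      (2 * b / a ^ (1 / (2 * b)) * 3 ^ (1 + 1 / (2 * b)))
  refine Integrable.mono' hg ?_ ?_
  · exact Measurable.aestronglyMeasurable (by fun_prop)
  · refine (ae_restrict_iff' measurableSet_Ioi).2 (Filter.Eventually.of_forall fun z hz => ?_)
    have hz : 0 < z := hz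
    rw [Real.norm_of_nonneg (mul_nonneg (Real.exp_pos _).le (aux_nonneg p a b z hp ha hz))]
    have := mul_le_mul_of_nonneg_left (aux_bound_s8 p a b z hp ha hb hz)
      (Real.exp_pos (-(1 / 2) * z ^ 2)).le
    refine this.trans (le_of_eq ?_)
    simp only [Pi.add_apply]
    ring

/-- For the shift function `f(z) = a z^b` with `a, b > 0`, the boundary
contribution `I₁(σ)` to the Gaussian average of the sKL divergence goes to zero
faster than any power of `σ` as `σ → 0⁺`. -/
theorem I1_superpolynomial_decay (p q a b : ℝ)
    (hp : 0 < p) (hq : 0 < q) (ha : 0 < a) (hb : 0 < b) :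
    ∀ k : ℕ, Filter.Tendsto
      (fun σ : ℝ =>
        ((1 / Real.sqrt (2 * Real.pi * σ ^ 2)) *
          ∫ z in Set.Ioi (0 : ℝ), Real.exp (-(q + z) ^ 2 / (2 * σ ^ 2)) *
            ((p + z + a * z ^ b) * Real.log ((p + z + a * z ^ b) / (a * z ^ b)))) / σ ^ k)
      (nhdsWithin 0 (Set.Ioi 0)) (nhds 0) := by
  intro k
  have hint := aux_int_s8 p a b hp ha hb
  set G : ℝ → ℝ := fun z =>
    (p + z + a * z ^ b) * Real.log ((p + z + a * z ^ b) / (a * z ^ b)) with hG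
  have hG0 : ∀ z, 0 < z → 0 ≤ G z := fun z hz => aux_nonneg p a b z hp ha hz
  set C := ∫ z in Set.Ioi (0 : ℝ), Real.exp (-(1 / 2) * z ^ 2) * G z with hC
  have hlim : Filter.Tendsto (fun σ : ℝ => (C / Real.sqrt (2 * Real.pi) / (q ^ 2 / 2) ^ (k + 1)) *
      ((q ^ 2 / 2 * (σ⁻¹) ^ 2) ^ (k + 1) * Real.exp (-(q ^ 2 / 2 * (σ⁻¹) ^ 2)) * σ ^ (k + 1)))
      (nhdsWithin 0 (Set.Ioi 0)) (nhds 0) := by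
    have h1 : Filter.Tendsto (fun σ : ℝ => q ^ 2 / 2 * (σ⁻¹) ^ 2)
        (nhdsWithin 0 (Set.Ioi 0)) Filter.atTop :=
      Filter.Tendsto.const_mul_atTop (by positivity)
        ((Filter.tendsto_pow_atTop two_ne_zero).comp tendsto_inv_nhdsGT_zero)
    have h2 := (Real.tendsto_pow_mul_exp_neg_atTop_nhds_zero (k + 1)).comp h1
    have h3 : Filter.Tendsto (fun σ : ℝ => σ ^ (k + 1)) (nhdsWithin 0 (Set.Ioi 0)) (nhds 0) := by
      have : Filter.Tendsto (fun σ : ℝ => σ ^ (k + 1)) (nhds 0) (nhds (0 ^ (k + 1))) :=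
        (continuous_pow (k + 1)).tendsto 0
      rw [zero_pow (Nat.succ_ne_zero k)] at this
      exact this.mono_left nhdsWithin_le_nhds
    have h4 := (h2.mul h3).const_mul (C / Real.sqrt (2 * Real.pi) / (q ^ 2 / 2) ^ (k + 1))
    simpa using h4
  have hmem : Set.Ioo (0 : ℝ) 1 ∈ nhdsWithin (0 : ℝ) (Set.Ioi 0) :=
    Ioo_mem_nhdsGT one_pos
  refine squeeze_zero' ?_ ?_ hlim
  · filter_upwards [hmem] with σ hσ
    have hσ0 : 0 < σ := hσ.1
    refine div_nonneg (mul_nonneg (by positivity) ?_) (by positivity)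
    exact setIntegral_nonneg measurableSet_Ioi
      fun z hz => mul_nonneg (Real.exp_pos _).le (hG0 z hz)
  · filter_upwards [hmem] with σ hσ
    have hσ0 : 0 < σ := hσ.1
    have hI : ∫ z in Set.Ioi (0 : ℝ), Real.exp (-(q + z) ^ 2 / (2 * σ ^ 2)) * G z
        ≤ Real.exp (-(q ^ 2 / 2 * (σ⁻¹) ^ 2)) * C := by
      rw [hC, ← integral_const_mul]
      refine integral_mono_of_nonneg ?_ (hint.const_mul _) ?_
      · exact (ae_restrict_iff' measurableSet_Ioi).2 (Filter.Eventually.of_forall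
          fun z hz => mul_nonneg (Real.exp_pos _).le (hG0 z hz))
      · refine (ae_restrict_iff' measurableSet_Ioi).2 (Filter.Eventually.of_forall
          fun z hz => ?_)
        have hz : 0 < z := hz
        show Real.exp (-(q + z) ^ 2 / (2 * σ ^ 2)) * G z ≤
          Real.exp (-(q ^ 2 / 2 * (σ⁻¹) ^ 2)) * (Real.exp (-(1 / 2) * z ^ 2) * G z)
        rw [← mul_assoc (Real.exp (-(q ^ 2 / 2 * (σ⁻¹) ^ 2))), ← Real.exp_add]
        refine mul_le_mul_of_nonneg_right (Real.exp_le_exp.2 ?_) (hG0 z hz)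
        have hi : 1 ≤ (σ⁻¹) ^ 2 := one_le_pow₀ ((one_le_inv₀ hσ0).2 hσ.2.le)
        have : -(q + z) ^ 2 / (2 * σ ^ 2) = -((q + z) ^ 2 / 2 * (σ⁻¹) ^ 2) := by
          field_simp
        rw [this]
        have h5 : 0 ≤ q * z * (σ⁻¹) ^ 2 := by positivity
        have h6 : 0 ≤ z ^ 2 * ((σ⁻¹) ^ 2 - 1) := mul_nonneg (by positivity) (by linarith)
        nlinarith
    have hs : Real.sqrt (2 * Real.pi * σ ^ 2) = Real.sqrt (2 * Real.pi) * σ := by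
      rw [Real.sqrt_mul (by positivity), Real.sqrt_sq hσ0.le]
    rw [hs]
    have hpi : 0 < Real.sqrt (2 * Real.pi) := Real.sqrt_pos.2 (by positivity)
    calc _ ≤ (1 / (Real.sqrt (2 * Real.pi) * σ) *
          (Real.exp (-(q ^ 2 / 2 * (σ⁻¹) ^ 2)) * C)) / σ ^ k := by gcongr
      _ = _ := by
        generalize Real.exp (-(q ^ 2 / 2 * (σ⁻¹) ^ 2)) = E
        rw [mul_pow (q ^ 2 / 2)]
        have : 0 < (q ^ 2 / 2) ^ (k + 1) := by positivity
        generalize (q ^ 2 / 2) ^ (k + 1) = Q at *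
        rw [← pow_mul, inv_pow, mul_comm 2 (k + 1), pow_mul]
        have : 0 < σ ^ k := by positivity
        field_simp
        try ring
end

section
/- Let p, q > 0 and let f : [0, ∞) → ℝ be continuous with f(0) > 0, bounded below by some m > 0, and polynomially bounded (|f(z)| ≤ A(1+z)^k for some A > 0 and k ∈ ℕ). For σ > 0 define I₁(σ) = (1/√(2πσ²)) ∫₀^∞ e^{−(q+z)²/(2σ²)} (p + z + f(z)) log((p + z + f(z))/f(z)) dz. Then lim_{σ→0⁺} [ √(2π) q e^{q²/(2σ²)} / σ ] · I₁(σ) = (p + f(0)) log((p + f(0))/f(0)); equivalently, I₁(σ) is asymptotic to (σ/(√(2π) q)) e^{−q²/(2σ²)} (p + f(0)) log((p + f(0))/f(0)) as σ → 0⁺. -/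
open MeasureTheory

/-- Leading-order asymptotics of the boundary contribution `I₁(σ)`: if the
shift function `f` is continuous on `[0, ∞)`, bounded below by a positive
constant, satisfies `f(0) > 0`, and is polynomially bounded, then
`I₁(σ) ~ (σ/(√(2π) q)) e^{-q²/(2σ²)} (p + f(0)) log((p + f(0))/f(0))` as
`σ → 0⁺`. -/
theorem I1_leading_asymptotics (p q : ℝ) (hp : 0 < p) (hq : 0 < q)
    (f : ℝ → ℝ) (hcont : ContinuousOn f (Set.Ici 0)) (hf0 : 0 < f 0)
    (m : ℝ) (hm : 0 < m) (hlb : ∀ z : ℝ, 0 ≤ z → m ≤ f z)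
    (A : ℝ) (hA : 0 < A) (k : ℕ) (hub : ∀ z : ℝ, 0 ≤ z → |f z| ≤ A * (1 + z) ^ k) :
    Filter.Tendsto
      (fun σ : ℝ =>
        (Real.sqrt (2 * Real.pi) * q * Real.exp (q ^ 2 / (2 * σ ^ 2)) / σ) *
          ((1 / Real.sqrt (2 * Real.pi * σ ^ 2)) *
            ∫ z in Set.Ioi (0 : ℝ), Real.exp (-(q + z) ^ 2 / (2 * σ ^ 2)) *
              ((p + z + f z) * Real.log ((p + z + f z) / f z))))
      (nhdsWithin 0 (Set.Ioi 0))
      (nhds ((p + f 0) * Real.log ((p + f 0) / f 0))) := by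
  set g : ℝ → ℝ := fun z => (p + z + f z) * Real.log ((p + z + f z) / f z) with hg
  have hfpos : ∀ z : ℝ, 0 ≤ z → 0 < f z := fun z hz => lt_of_lt_of_le hm (hlb z hz)
  have hgc : ContinuousOn g (Set.Ici 0) := by
    have h1 : ContinuousOn (fun z => p + z + f z) (Set.Ici 0) :=
      (continuousOn_const.add continuousOn_id).add hcont
    refine h1.mul (ContinuousOn.log (h1.div hcont ?_) ?_)
    · intro z hz
      exact (hfpos z hz).ne'
    · intro z hz
      have := hfpos z hz
      have hz' : (0 : ℝ) ≤ z := hz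
      positivity
  obtain ⟨C, hC0, hC⟩ : ∃ C : ℝ, 0 ≤ C ∧ ∀ z t : ℝ, 0 ≤ z → z ≤ t →
      |g z| ≤ C * Real.exp ((q / 2) * t) := by
    set n : ℕ := 2 * (k + 1) with hn
    refine ⟨(p + 1 + A) ^ 2 / m * (n.factorial * (2 / q) ^ n * Real.exp (q / 2)), by positivity, ?_⟩
    intro z t hz hzt
    have hf := hfpos z hz
    have ht : 0 ≤ t := hz.trans hzt
    have hge1 : 1 ≤ (p + z + f z) / f z := by
      rw [le_div_iff₀ hf]; linarith
    have hlog0 := Real.log_nonneg hge1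
    have hlog1 : Real.log ((p + z + f z) / f z) ≤ (p + z + f z) / m := by
      refine (Real.log_le_self (by linarith)).trans ?_
      exact div_le_div_of_nonneg_left (by positivity) hm (hlb z hz)
    have hf2 : f z ≤ A * (1 + t) ^ (k + 1) := by
      calc f z ≤ A * (1 + z) ^ k := (le_abs_self _).trans (hub z hz)
        _ ≤ A * (1 + t) ^ k := by gcongr
        _ ≤ A * (1 + t) ^ (k + 1) := by
          gcongr
          · linarith
          · omega
    have hb : p + z + f z ≤ (p + 1 + A) * (1 + t) ^ (k + 1) := by
      have h1 : 1 + t ≤ (1 + t) ^ (k + 1) := le_self_pow₀ (by linarith) (by omega)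
      have h2 : p * 1 ≤ p * (1 + t) ^ (k + 1) := by
        gcongr; linarith
      nlinarith
    have hpow : (1 + t) ^ n ≤ n.factorial * (2 / q) ^ n * Real.exp (q / 2) * Real.exp ((q / 2) * t) := by
      have h := Real.pow_div_factorial_le_exp (q / 2 * (1 + t)) (by positivity) n
      rw [div_le_iff₀ (by positivity)] at h
      have e : (1 + t) ^ n = (2 / q) ^ n * (q / 2 * (1 + t)) ^ n := by
        rw [← mul_pow]; congr 1; field_simp
      rw [e]
      have e2 : Real.exp (q / 2 * (1 + t)) = Real.exp (q / 2) * Real.exp ((q / 2) * t) := by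
        rw [← Real.exp_add]; congr 1; ring
      rw [e2] at h
      calc _ ≤ (2 / q) ^ n * (Real.exp (q / 2) * Real.exp ((q / 2) * t) * n.factorial) := by gcongr
        _ = _ := by ring
    have hgn : 0 ≤ g z := by
      simp only [hg]; positivity
    rw [abs_of_nonneg hgn]
    calc g z ≤ (p + z + f z) * ((p + z + f z) / m) := by
          simp only [hg]; gcongr
      _ = (p + z + f z) ^ 2 / m := by ring
      _ ≤ ((p + 1 + A) * (1 + t) ^ (k + 1)) ^ 2 / m := by gcongr
      _ = (p + 1 + A) ^ 2 / m * (1 + t) ^ n := by rw [hn, mul_pow, ← pow_mul]; ring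
      _ ≤ (p + 1 + A) ^ 2 / m * (n.factorial * (2 / q) ^ n * Real.exp (q / 2) * Real.exp ((q / 2) * t)) := by
          gcongr
      _ = _ := by ring
  have key : Filter.Tendsto (fun σ : ℝ => ∫ t in Set.Ioi (0 : ℝ),
      Real.exp (-q * t - σ ^ 2 * t ^ 2 / 2) * g (σ ^ 2 * t))
      (nhdsWithin 0 (Set.Ioi 0)) (nhds (∫ t in Set.Ioi (0 : ℝ), Real.exp (-q * t) * g 0)) := by
    refine tendsto_integral_filter_of_dominated_convergence
      (fun t => C * Real.exp (-(q / 2) * t)) ?_ ?_ ?_ ?_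
    · refine Filter.Eventually.of_forall fun σ => ?_
      refine ContinuousOn.aestronglyMeasurable ?_ measurableSet_Ioi
      refine ContinuousOn.mul (by fun_prop) ?_
      refine hgc.comp (by fun_prop) ?_
      intro t ht
      have : (0 : ℝ) < t := ht
      simp only [Set.mem_Ici]; positivity
    · have h1 : ∀ᶠ σ : ℝ in nhdsWithin 0 (Set.Ioi 0), σ ∈ Set.Ioo (0 : ℝ) 1 :=
        Ioo_mem_nhdsGT one_pos
      filter_upwards [h1] with σ hσ
      refine (ae_restrict_iff' measurableSet_Ioi).2 (Filter.Eventually.of_forall fun t ht => ?_)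
      have ht0 : (0 : ℝ) < t := ht
      have hσ2 : σ ^ 2 ≤ 1 := pow_le_one₀ hσ.1.le hσ.2.le
      have hb := hC (σ ^ 2 * t) t (by positivity) (by nlinarith)
      rw [norm_mul, Real.norm_eq_abs, Real.norm_eq_abs, Real.abs_exp]
      have he : Real.exp (-q * t - σ ^ 2 * t ^ 2 / 2) ≤ Real.exp (-q * t) := by
        apply Real.exp_le_exp.2
        have : 0 ≤ σ ^ 2 * t ^ 2 / 2 := by positivity
        linarith
      calc _ ≤ Real.exp (-q * t) * (C * Real.exp ((q / 2) * t)) := by gcongr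
        _ = C * (Real.exp (-q * t) * Real.exp ((q / 2) * t)) := by ring
        _ = _ := by rw [← Real.exp_add]; congr 2; ring
    · exact (exp_neg_integrableOn_Ioi 0 (half_pos hq)).const_mul C
    · refine (ae_restrict_iff' measurableSet_Ioi).2 (Filter.Eventually.of_forall fun t ht => ?_)
      have ht0 : (0 : ℝ) < t := ht
      refine Filter.Tendsto.mul ?_ ?_
      · have : Continuous (fun σ : ℝ => Real.exp (-q * t - σ ^ 2 * t ^ 2 / 2)) := by fun_prop
        have h := (this.tendsto 0).mono_left (nhdsWithin_le_nhds (s := Set.Ioi 0))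
        simpa using h
      · have h0 : Filter.Tendsto g (nhdsWithin 0 (Set.Ici 0)) (nhds (g 0)) :=
          hgc 0 Set.self_mem_Ici
        refine h0.comp (tendsto_nhdsWithin_iff.2 ⟨?_, ?_⟩)
        · have : Continuous (fun σ : ℝ => σ ^ 2 * t) := by fun_prop
          have h := (this.tendsto 0).mono_left (nhdsWithin_le_nhds (s := Set.Ioi 0))
          simpa using h
        · refine Filter.Eventually.of_forall fun σ => ?_
          simp only [Set.mem_Ici]; positivity
  have hlim : q * (∫ t in Set.Ioi (0 : ℝ), Real.exp (-q * t) * g 0)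
      = (p + f 0) * Real.log ((p + f 0) / f 0) := by
    rw [integral_mul_const, integral_exp_mul_Ioi (by linarith)]
    simp only [hg, mul_zero, Real.exp_zero, add_zero]
    field_simp
  rw [← hlim]
  refine (key.const_mul q).congr' ?_
  filter_upwards [self_mem_nhdsWithin] with σ hσ
  have hσ0 : (0 : ℝ) < σ := hσ
  have hsub := integral_comp_mul_left_Ioi
    (fun z => Real.exp (-(q + z) ^ 2 / (2 * σ ^ 2)) * g z) 0 (b := σ ^ 2) (by positivity)
  rw [mul_zero, smul_eq_mul] at hsub
  have hsub' : (∫ z in Set.Ioi (0 : ℝ), Real.exp (-(q + z) ^ 2 / (2 * σ ^ 2)) * g z)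
      = σ ^ 2 * ∫ t in Set.Ioi (0 : ℝ),
        Real.exp (-(q + σ ^ 2 * t) ^ 2 / (2 * σ ^ 2)) * g (σ ^ 2 * t) := by
    rw [hsub]; field_simp
  have hexp : (∫ t in Set.Ioi (0 : ℝ),
        Real.exp (-(q + σ ^ 2 * t) ^ 2 / (2 * σ ^ 2)) * g (σ ^ 2 * t))
      = Real.exp (-(q ^ 2 / (2 * σ ^ 2))) * ∫ t in Set.Ioi (0 : ℝ),
        Real.exp (-q * t - σ ^ 2 * t ^ 2 / 2) * g (σ ^ 2 * t) := by
    rw [← integral_const_mul]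
    congr 1
    funext t
    generalize g (σ ^ 2 * t) = G
    rw [← mul_assoc, ← Real.exp_add]
    congr 2
    field_simp
    ring
  rw [hsub', hexp, Real.sqrt_mul (by positivity : 0 ≤ 2 * Real.pi), Real.sqrt_sq hσ0.le, Real.exp_neg]
  have hs : Real.sqrt (2 * Real.pi) ≠ 0 := by positivity
  have he := Real.exp_ne_zero (q ^ 2 / (2 * σ ^ 2))
  generalize (∫ t in Set.Ioi (0 : ℝ),
    Real.exp (-q * t - σ ^ 2 * t ^ 2 / 2) * g (σ ^ 2 * t)) = J at *
  generalize Real.exp (q ^ 2 / (2 * σ ^ 2)) = E at *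
  generalize Real.sqrt (2 * Real.pi) = S at *
  field_simp
end

section
/- Let p, q, σ > 0 be real numbers and let f(z) = e^{−1/z} for z > 0. Then the function z ↦ e^{−(q+z)²/(2σ²)} (p + z + f(z)) log((p + z + f(z))/f(z)) is NOT integrable on (0, ∞): its integral diverges at the lower end of the integration interval. -/
open MeasureTheory

/-- For the shift function `f(z) = e^{-1/z}`, which tends to zero too rapidly
as `z → 0⁺`, the integrand of `I₁` is not integrable on `(0, ∞)`: its integral
diverges at the lower end of the integration interval (it is already
non-integrable on `(0, 1)`). -/
theorem I1_not_integrable_exp_neg_inv (p q σ : ℝ)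
    (hp : 0 < p) (hq : 0 < q) (hσ : 0 < σ) :
    ¬ IntegrableOn
        (fun z : ℝ => Real.exp (-(q + z) ^ 2 / (2 * σ ^ 2)) *
          ((p + z + Real.exp (-1 / z)) *
            Real.log ((p + z + Real.exp (-1 / z)) / Real.exp (-1 / z))))
        (Set.Ioi 0) ∧
    ¬ IntegrableOn
        (fun z : ℝ => Real.exp (-(q + z) ^ 2 / (2 * σ ^ 2)) *
          ((p + z + Real.exp (-1 / z)) *
            Real.log ((p + z + Real.exp (-1 / z)) / Real.exp (-1 / z))))
        (Set.Ioo 0 1) := by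
  have key : ¬ IntegrableOn
        (fun z : ℝ => Real.exp (-(q + z) ^ 2 / (2 * σ ^ 2)) *
          ((p + z + Real.exp (-1 / z)) *
            Real.log ((p + z + Real.exp (-1 / z)) / Real.exp (-1 / z))))
        (Set.Ioo 0 1) := by
    intro h
    set c := Real.exp (-(q + 1) ^ 2 / (2 * σ ^ 2)) with hc
    have hc0 : 0 < c := Real.exp_pos _
    have hcp : 0 < c * p := mul_pos hc0 hp
    have hconst : IntegrableOn (fun _ : ℝ => |Real.log p|) (Set.Ioo (0 : ℝ) 1) := by
      refine integrableOn_const ?_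
      simp
    have h2 := (h.const_mul (c * p)⁻¹).add hconst
    have h3 : IntegrableOn (fun z : ℝ => z⁻¹) (Set.Ioo (0 : ℝ) 1) := by
      refine Integrable.mono' h2 (by fun_prop) ?_
      refine (ae_restrict_iff' measurableSet_Ioo).2 (Filter.Eventually.of_forall ?_)
      rintro z ⟨hz0, hz1⟩
      have hf : 0 < Real.exp (-1 / z) := Real.exp_pos _
      have hA : p ≤ p + z + Real.exp (-1 / z) := by linarith
      have hE : c ≤ Real.exp (-(q + z) ^ 2 / (2 * σ ^ 2)) := by
        apply Real.exp_le_exp.2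
        apply div_le_div_of_nonneg_right _ (by positivity)
        nlinarith
      have hL0 : 0 ≤ Real.log ((p + z + Real.exp (-1 / z)) / Real.exp (-1 / z)) := by
        apply Real.log_nonneg
        rw [le_div_iff₀ hf]
        linarith
      have hL : Real.log p + z⁻¹ ≤
          Real.log ((p + z + Real.exp (-1 / z)) / Real.exp (-1 / z)) := by
        rw [Real.log_div (by linarith) hf.ne', Real.log_exp]
        have := Real.log_le_log hp hA
        have e : -1 / z = - z⁻¹ := by ring
        rw [e] at this ⊢
        linarith
      have hF : c * p * Real.log ((p + z + Real.exp (-1 / z)) / Real.exp (-1 / z)) ≤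
          Real.exp (-(q + z) ^ 2 / (2 * σ ^ 2)) * ((p + z + Real.exp (-1 / z)) *
            Real.log ((p + z + Real.exp (-1 / z)) / Real.exp (-1 / z))) := by
        rw [← mul_assoc]
        gcongr
      have hF2 := (le_inv_mul_iff₀ hcp).2 hF
      rw [Real.norm_of_nonneg (by positivity)]
      have := neg_abs_le (Real.log p)
      simp only [Pi.add_apply]
      linarith
    have h4 : IntervalIntegrable (fun z : ℝ => z⁻¹) volume 0 1 := by
      rw [intervalIntegrable_iff_integrableOn_Ioo_of_le zero_le_one]
      exact h3
    rw [intervalIntegrable_inv_iff] at h4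
    simp at h4
  exact ⟨fun h => key (h.mono_set Set.Ioo_subset_Ioi_self), key⟩
end

section
/- Let p, q, σ > 0 be real numbers and let f(z) = exp(−exp(z⁴)) for z ≥ 0. Then the function z ↦ e^{−(q+z)²/(2σ²)} (p + z + f(z)) log((p + z + f(z))/f(z)) is NOT integrable on (0, ∞): its integral diverges at the upper end of the integration interval. -/
open MeasureTheory

/-- Pointwise lower bound: the integrand is at least one far out. -/
theorem I1_aux_bound (p q σ : ℝ) (hp : 0 < p) (hq : 0 < q) (hσ : 0 < σ) (z : ℝ)
    (hz : 1 + q + 2 / σ ^ 2 < z) :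
    1 ≤ Real.exp (-(q + z) ^ 2 / (2 * σ ^ 2)) *
          ((p + z + Real.exp (-Real.exp (z ^ 4))) *
            Real.log ((p + z + Real.exp (-Real.exp (z ^ 4))) /
              Real.exp (-Real.exp (z ^ 4)))) := by
  have hc : 0 < 2 / σ ^ 2 := by positivity
  have hz1 : 1 ≤ z := by linarith
  have hf : 0 < Real.exp (-Real.exp (z ^ 4)) := Real.exp_pos _
  have hlog : Real.exp (z ^ 4) ≤ Real.log ((p + z + Real.exp (-Real.exp (z ^ 4))) /
              Real.exp (-Real.exp (z ^ 4))) := by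
    rw [Real.log_div (by positivity) hf.ne', Real.log_exp]
    have := Real.log_nonneg (x := p + z + Real.exp (-Real.exp (z ^ 4))) (by linarith)
    linarith
  have he : 0 < Real.exp (z ^ 4) := Real.exp_pos _
  have h1 : Real.exp (z ^ 4) ≤ (p + z + Real.exp (-Real.exp (z ^ 4))) *
            Real.log ((p + z + Real.exp (-Real.exp (z ^ 4))) /
              Real.exp (-Real.exp (z ^ 4))) := by
    refine hlog.trans (le_mul_of_one_le_left (he.le.trans hlog) (by linarith))
  refine le_trans ?_ (mul_le_mul_of_nonneg_left h1 (Real.exp_pos _).le)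
  rw [← Real.exp_add]
  apply Real.one_le_exp
  have e : -(q + z) ^ 2 / (2 * σ ^ 2) = -((q + z) ^ 2 * (2 / σ ^ 2) / 4) := by
    field_simp
    ring
  rw [e]
  have h2 : (q + z) ^ 2 ≤ 4 * z ^ 2 := by nlinarith
  have h3 : 2 / σ ^ 2 ≤ z ^ 2 := by nlinarith
  have h4 := mul_le_mul h2 h3 hc.le (by positivity)
  nlinarith

/-- For the shift function `f(z) = exp(-exp(z⁴))`, which tends to zero too
rapidly as `z → ∞`, the integrand of `I₁` is not integrable on `(0, ∞)`: its
integral diverges at the upper end of the integration interval (it is already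
non-integrable on `(1, ∞)`). -/
theorem I1_not_integrable_exp_neg_exp (p q σ : ℝ)
    (hp : 0 < p) (hq : 0 < q) (hσ : 0 < σ) :
    ¬ IntegrableOn
        (fun z : ℝ => Real.exp (-(q + z) ^ 2 / (2 * σ ^ 2)) *
          ((p + z + Real.exp (-Real.exp (z ^ 4))) *
            Real.log ((p + z + Real.exp (-Real.exp (z ^ 4))) /
              Real.exp (-Real.exp (z ^ 4)))))
        (Set.Ioi 0) ∧
    ¬ IntegrableOn
        (fun z : ℝ => Real.exp (-(q + z) ^ 2 / (2 * σ ^ 2)) *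
          ((p + z + Real.exp (-Real.exp (z ^ 4))) *
            Real.log ((p + z + Real.exp (-Real.exp (z ^ 4))) /
              Real.exp (-Real.exp (z ^ 4)))))
        (Set.Ioi 1) := by
  have key : ¬ IntegrableOn
        (fun z : ℝ => Real.exp (-(q + z) ^ 2 / (2 * σ ^ 2)) *
          ((p + z + Real.exp (-Real.exp (z ^ 4))) *
            Real.log ((p + z + Real.exp (-Real.exp (z ^ 4))) /
              Real.exp (-Real.exp (z ^ 4)))))
        (Set.Ioi 1) := by
    intro h
    have hc : 0 < 2 / σ ^ 2 := by positivity
    have h' := h.mono_set (Set.Ioi_subset_Ioi (show 1 ≤ 1 + q + 2 / σ ^ 2 by linarith))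
    have hone : IntegrableOn (fun _ : ℝ => (1 : ℝ)) (Set.Ioi (1 + q + 2 / σ ^ 2)) := by
      refine Integrable.mono h' aestronglyMeasurable_const ?_
      refine (ae_restrict_iff' measurableSet_Ioi).2 (Filter.Eventually.of_forall ?_)
      intro z hz
      rw [norm_one]
      exact (I1_aux_bound p q σ hp hq hσ z hz).trans (Real.le_norm_self _)
    rw [integrableOn_const_iff] at hone
    simp at hone
  exact ⟨fun h => key (h.mono_set (Set.Ioi_subset_Ioi zero_le_one)), key⟩
end
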